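/- arXiv:1111.6716 — 4 statements merged into one kernel-verified Lean document; each statement's English description precedes it below -/
import Mathlib

section
/- Let C, D be integers with 0 ≤ C, D ≤ q−1 such that the integral ideal (C + Dδ)𝔟 is coprime to qO_K, and let ε be a totally positive unit of O_K. Then (C + Dδ)·(ε − 1) ∈ q𝔟⁻¹ if and only if ε ≡ 1 (mod qO_K). -/
open NumberField FractionalIdeal
open scoped nonZeroDivisors

/-- Lemma 2.1 of Jun–Lee: for `0 ≤ C, D ≤ q-1` with `(C + Dδ)𝔟` coprime to `qO_K`, and a
totally positive unit `ε` of `O_K`, one has `(C + Dδ)(ε - 1) ∈ q𝔟⁻¹` iff `ε ≡ 1 (mod qO_K)`.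
Here `K` is a real quadratic field with embeddings `σ, σ'` and `𝔟` is an integral ideal
coprime to `q` with `𝔟⁻¹ = ℤ + ℤδ`, `δ > 2`, `0 < δ' < 1`. -/
theorem stmt_1 {K : Type*} [Field K] [NumberField K]
    (hdeg : Module.finrank ℚ K = 2)
    (σ σ' : K →+* ℝ) (hσσ' : σ ≠ σ')
    (q : ℕ) (hq : 0 < q)
    (𝔟 : Ideal (𝓞 K)) (hbcop : IsCoprime 𝔟 (Ideal.span {(q : 𝓞 K)}))
    (δ : K) (hδ2 : 2 < σ δ) (hδ'0 : 0 < σ' δ) (hδ'1 : σ' δ < 1)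
    (hbinv : ∀ z : K,
      z ∈ ((𝔟 : FractionalIdeal (𝓞 K)⁰ K))⁻¹ ↔ ∃ a b : ℤ, z = (a : K) + (b : K) * δ)
    (C D : ℤ) (hC : 0 ≤ C) (hCq : C ≤ (q:ℤ) - 1) (hD : 0 ≤ D) (hDq : D ≤ (q:ℤ) - 1)
    (I : Ideal (𝓞 K))
    (hI : (I : FractionalIdeal (𝓞 K)⁰ K)
          = spanSingleton (𝓞 K)⁰ ((C : K) + (D : K) * δ) * (𝔟 : FractionalIdeal (𝓞 K)⁰ K))
    (hIcop : IsCoprime I (Ideal.span {(q : 𝓞 K)}))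
    (ε : (𝓞 K)ˣ) (hε : 0 < σ ((ε : 𝓞 K) : K) ∧ 0 < σ' ((ε : 𝓞 K) : K)) :
    (((C : K) + (D : K) * δ) * (((ε : 𝓞 K) : K) - 1)
        ∈ spanSingleton (𝓞 K)⁰ (q : K) * ((𝔟 : FractionalIdeal (𝓞 K)⁰ K))⁻¹)
      ↔ ∃ y : 𝓞 K, (ε : 𝓞 K) = 1 + (q : 𝓞 K) * y := by
  rw [FractionalIdeal.mem_singleton_mul]
  constructor
  · rintro ⟨w, hw, hαw⟩
    obtain ⟨i, hi, j, hj, hij⟩ := Ideal.isCoprime_iff_exists.mp hIcop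
    obtain ⟨s, rfl⟩ := Ideal.mem_span_singleton'.mp hj
    have hiI : (i : K) ∈ (I : FractionalIdeal (𝓞 K)⁰ K) :=
      FractionalIdeal.mem_coeIdeal_of_mem _ hi
    rw [hI, FractionalIdeal.mem_singleton_mul] at hiI
    obtain ⟨b, hb, hib⟩ := hiI
    have h𝔟 : (𝔟 : FractionalIdeal (𝓞 K)⁰ K) ≠ 0 := by
      intro h
      have h1 := (hbinv 1).mpr ⟨1, 0, by simp⟩
      rw [h, FractionalIdeal.inv_zero', FractionalIdeal.mem_zero_iff] at h1
      exact one_ne_zero h1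
    have hwb := (FractionalIdeal.mem_inv_iff h𝔟).mp hw b hb
    obtain ⟨t, ht⟩ := (FractionalIdeal.mem_one_iff _).mp hwb
    refine ⟨t + s * (ε - 1), ?_⟩
    apply RingOfIntegers.ext
    have hij' : (i : K) + s * q = 1 := by
      have := congrArg (algebraMap (𝓞 K) K) hij
      simpa using this
    have ht' : (t : K) = w * b := ht
    have hib' : (i : K) = (C + D * δ) * b := hib
    push_cast
    simp only [ht']
    linear_combination (-((ε : 𝓞 K) : K) + 1) * hij' + (((ε : 𝓞 K) : K) - 1) * hib' + b * hαw
  · rintro ⟨y, hy⟩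
    refine ⟨(y : K) * (C + D * δ), ?_, ?_⟩
    · rw [← Algebra.smul_def]
      exact Submodule.smul_mem _ y ((hbinv _).mpr ⟨C, D, rfl⟩)
    · rw [hy]
      simp only [map_add, map_mul, map_one, map_natCast]
      ring
end

section
/- Let C, D be integers with 0 ≤ C, D ≤ q−1. Then the following are equivalent: (1) the integral ideal (C + Dδ)𝔟 is coprime to qO_K; (2) for every α ∈ (C + Dδ)/q + 𝔟⁻¹, the ideal q·α·𝔟 (which is an integral ideal of O_K) is coprime to qO_K; (3) there exists α ∈ (C + Dδ)/q + 𝔟⁻¹ such that the ideal q·α·𝔟 is coprime to qO_K. -/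
open NumberField FractionalIdeal
open scoped nonZeroDivisors

/-- If `y - x = q w` with `w ∈ 𝔟⁻¹` and `x𝔟` is an integral ideal coprime to `q`,
then so is `y𝔟`. -/
theorem exists_coprime_of_sub_eq_mul {R K : Type*} [CommRing R] [IsDedekindDomain R] [Field K]
    [Algebra R K] [IsFractionRing R K] {𝔟 : Ideal R} (h𝔟 : 𝔟 ≠ ⊥) {q : R} {x y w : K}
    (hw : w ∈ (𝔟 : FractionalIdeal R⁰ K)⁻¹) (hxy : y - x = algebraMap R K q * w)
    (h : ∃ I : Ideal R,
      (I : FractionalIdeal R⁰ K) = spanSingleton R⁰ x * (𝔟 : FractionalIdeal R⁰ K) ∧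
        IsCoprime I (Ideal.span {q})) :
    ∃ J : Ideal R,
      (J : FractionalIdeal R⁰ K) = spanSingleton R⁰ y * (𝔟 : FractionalIdeal R⁰ K) ∧
        IsCoprime J (Ideal.span {q}) := by
  obtain ⟨I, hI, hcop⟩ := h
  have hwb : ∀ b ∈ 𝔟, ∃ r : R, algebraMap R K r = w * algebraMap R K b := fun b hb =>
    (mem_one_iff _).1 <|
      (mem_inv_iff (coeIdeal_ne_zero.2 h𝔟)).1 hw _ (mem_coeIdeal_of_mem _ hb)
  have hle : spanSingleton R⁰ y * (𝔟 : FractionalIdeal R⁰ K) ≤ 1 := by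
    rw [spanSingleton_mul_le_iff]
    intro z hz
    obtain ⟨b, hb, rfl⟩ := (mem_coeIdeal _).1 hz
    obtain ⟨r, hr⟩ := hwb b hb
    have hx : x * algebraMap R K b ∈ (I : FractionalIdeal R⁰ K) := by
      rw [hI]
      exact mul_mem_mul (mem_spanSingleton_self _ _) hz
    obtain ⟨s, -, hs⟩ := (mem_coeIdeal _).1 hx
    refine (mem_one_iff _).2 ⟨s + q * r, ?_⟩
    rw [map_add, map_mul, hs, hr]
    linear_combination -hxy * algebraMap R K b
  obtain ⟨J, hJ⟩ := le_one_iff_exists_coeIdeal.1 hle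
  refine ⟨J, hJ, ?_⟩
  rw [Ideal.isCoprime_iff_sup_eq, eq_top_iff, ← Ideal.isCoprime_iff_sup_eq.1 hcop]
  refine sup_le (fun i hi => ?_) le_sup_right
  have hi' := mem_coeIdeal_of_mem (P := K) R⁰ hi
  rw [hI, mem_singleton_mul] at hi'
  obtain ⟨z, hz, hiz⟩ := hi'
  obtain ⟨b, hb, rfl⟩ := (mem_coeIdeal _).1 hz
  obtain ⟨r, hr⟩ := hwb b hb
  have hy : y * algebraMap R K b ∈ (J : FractionalIdeal R⁰ K) := by
    rw [hJ]
    exact mul_mem_mul (mem_spanSingleton_self _ _) hz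
  obtain ⟨s, hsJ, hs⟩ := (mem_coeIdeal _).1 hy
  have his : i = s + q * -r := by
    apply IsFractionRing.injective R K
    rw [map_add, map_mul, map_neg, hs, hr, hiz]
    linear_combination -hxy * algebraMap R K b
  rw [his]
  exact Submodule.add_mem_sup hsJ (Ideal.mul_mem_right _ _ (Ideal.mem_span_singleton_self q))

/-- Lemma 2.2 of Jun–Lee: for `0 ≤ C, D ≤ q-1`, the following are equivalent:
(1) the integral ideal `(C + Dδ)𝔟` is coprime to `qO_K`;
(2) for every `α ∈ (C + Dδ)/q + 𝔟⁻¹`, the (integral) ideal `qα𝔟` is coprime to `qO_K`;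
(3) for some `α ∈ (C + Dδ)/q + 𝔟⁻¹`, the ideal `qα𝔟` is coprime to `qO_K`.
Integral ideals representing the fractional ideals are given by witnesses. -/
theorem stmt_2 {K : Type*} [Field K] [NumberField K]
    (hdeg : Module.finrank ℚ K = 2)
    (σ σ' : K →+* ℝ) (hσσ' : σ ≠ σ')
    (q : ℕ) (hq : 0 < q)
    (𝔟 : Ideal (𝓞 K)) (hbcop : IsCoprime 𝔟 (Ideal.span {(q : 𝓞 K)}))
    (δ : K) (hδ2 : 2 < σ δ) (hδ'0 : 0 < σ' δ) (hδ'1 : σ' δ < 1)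
    (hbinv : ∀ z : K,
      z ∈ ((𝔟 : FractionalIdeal (𝓞 K)⁰ K))⁻¹ ↔ ∃ a b : ℤ, z = (a : K) + (b : K) * δ)
    (C D : ℤ) (hC : 0 ≤ C) (hCq : C ≤ (q:ℤ) - 1) (hD : 0 ≤ D) (hDq : D ≤ (q:ℤ) - 1) :
    List.TFAE
      [ (∃ I : Ideal (𝓞 K),
          (I : FractionalIdeal (𝓞 K)⁰ K)
            = spanSingleton (𝓞 K)⁰ ((C : K) + (D : K) * δ) * (𝔟 : FractionalIdeal (𝓞 K)⁰ K)
          ∧ IsCoprime I (Ideal.span {(q : 𝓞 K)})),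
        (∀ α : K, (α - ((C : K) + (D : K) * δ) / (q : K)) ∈ ((𝔟 : FractionalIdeal (𝓞 K)⁰ K))⁻¹ →
          ∃ J : Ideal (𝓞 K),
            (J : FractionalIdeal (𝓞 K)⁰ K)
              = spanSingleton (𝓞 K)⁰ ((q : K) * α) * (𝔟 : FractionalIdeal (𝓞 K)⁰ K)
            ∧ IsCoprime J (Ideal.span {(q : 𝓞 K)})),
        (∃ α : K, (α - ((C : K) + (D : K) * δ) / (q : K)) ∈ ((𝔟 : FractionalIdeal (𝓞 K)⁰ K))⁻¹ ∧
          ∃ J : Ideal (𝓞 K),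
            (J : FractionalIdeal (𝓞 K)⁰ K)
              = spanSingleton (𝓞 K)⁰ ((q : K) * α) * (𝔟 : FractionalIdeal (𝓞 K)⁰ K)
            ∧ IsCoprime J (Ideal.span {(q : 𝓞 K)})) ] := by
  have hq0 : (q : K) ≠ 0 := Nat.cast_ne_zero.2 hq.ne'
  have h𝔟 : 𝔟 ≠ ⊥ := by
    rintro rfl
    have h1 := (hbinv 1).2 ⟨1, 0, by simp⟩
    simp at h1
  tfae_have 1 → 2 := fun h α hα =>
    exists_coprime_of_sub_eq_mul h𝔟 hα (by rw [map_natCast]; field_simp) h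
  tfae_have 2 → 3 := fun h => by
    have hmem : ((C : K) + (D : K) * δ) / (q : K) - ((C : K) + (D : K) * δ) / (q : K) ∈
        ((𝔟 : FractionalIdeal (𝓞 K)⁰ K))⁻¹ := (hbinv _).2 ⟨0, 0, by simp⟩
    exact ⟨_, hmem, h _ hmem⟩
  tfae_have 3 → 1 := fun ⟨α, hα, h⟩ =>
    exists_coprime_of_sub_eq_mul h𝔟 (neg_mem (S := Submodule (𝓞 K) K) hα)
      (by rw [map_natCast]; field_simp; ring) h
  tfae_finish
end

section
/- Let δ and δ′ be real numbers with δ > 1 and 0 < δ′ < 1, and let x ∈ (0,1] and y ∈ [0,1). Then the series Z(s) = Σ_{n₁≥0} Σ_{n₂≥0} [((x+n₁)δ + (y+n₂))·((x+n₁)δ′ + (y+n₂))]^{−s} converges absolutely for Re(s) > 1, and every function F analytic on a connected open set U ⊆ ℂ containing {s : Re(s) > 1} ∪ {0} and agreeing with Z on {s : Re(s) > 1} satisfies F(0) = ((δ + δ′)/4)·B₂(x) + B₁(x)·B₁(y) + (1/4)·(1/δ + 1/δ′)·B₂(y). -/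
/-- The first Bernoulli polynomial `B₁(x) = x - 1/2`. -/
noncomputable def B1 (x : ℝ) : ℝ := x - 1/2

/-- The second Bernoulli polynomial `B₂(x) = x² - x + 1/6`. -/
noncomputable def B2 (x : ℝ) : ℝ := x^2 - x + 1/6

open Complex Filter Topology MeasureTheory Set

/-- The `k`-th derivative at `t = 0` of `t ↦ (A + t) ^ (-p) * (B + t) ^ (-q)`. -/
noncomputable def powProdDeriv : ℕ → ℂ → ℂ → ℝ → ℝ → ℂ
  | 0, p, q, A, B => (A : ℂ) ^ (-p) * (B : ℂ) ^ (-q)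
  | k + 1, p, q, A, B =>
    -p * powProdDeriv k (p + 1) q A B - q * powProdDeriv k p (q + 1) A B

lemma hasDerivAt_add_ofReal_cpow (p : ℂ) {A t : ℝ} (hA : 0 < A + t) :
    HasDerivAt (fun u : ℝ => ((A + u : ℝ) : ℂ) ^ (-p))
      (-p * ((A + t : ℝ) : ℂ) ^ (-(p + 1))) t := by
  have h1 : HasDerivAt (fun u : ℝ => ((A + u : ℝ) : ℂ)) 1 t := by
    simpa using ((hasDerivAt_id t).const_add A).ofReal_comp
  have hne : ((A + t : ℝ) : ℂ) ∈ slitPlane := ofReal_mem_slitPlane.2 hA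
  have h2 := ((hasDerivAt_id ((A + t : ℝ) : ℂ)).cpow_const (c := -p) hne).comp t h1
  refine h2.congr_deriv ?_
  rw [mul_one, mul_one, neg_add']
  rfl

lemma hasDerivAt_powProdDeriv (k : ℕ) (p q : ℂ) {A B t : ℝ} (hA : 0 < A + t) (hB : 0 < B + t) :
    HasDerivAt (fun u : ℝ => powProdDeriv k p q (A + u) (B + u))
      (powProdDeriv (k + 1) p q (A + t) (B + t)) t := by
  induction k generalizing p q with
  | zero =>
    simp only [powProdDeriv]
    refine ((hasDerivAt_add_ofReal_cpow p hA).mul (hasDerivAt_add_ofReal_cpow q hB)).congr_deriv ?_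
    ring
  | succ k ih =>
    exact ((ih (p + 1) q).const_mul (-p)).sub ((ih p (q + 1)).const_mul q)

lemma differentiable_powProdDeriv (k : ℕ) {p q : ℂ → ℂ} (hp : Differentiable ℂ p)
    (hq : Differentiable ℂ q) {A B : ℝ} (hA : 0 < A) (hB : 0 < B) :
    Differentiable ℂ (fun s => powProdDeriv k (p s) (q s) A B) := by
  induction k generalizing p q with
  | zero =>
    simp only [powProdDeriv]
    have hA' : (A : ℂ) ≠ 0 := by exact_mod_cast hA.ne'
    have hB' : (B : ℂ) ≠ 0 := by exact_mod_cast hB.ne'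
    intro s
    exact ((hp s).neg.const_cpow (Or.inl hA')).mul ((hq s).neg.const_cpow (Or.inl hB'))
  | succ k ih =>
    simp only [powProdDeriv]
    exact (hp.neg.mul (ih (hp.add_const 1) hq)).sub (hq.mul (ih hp (hq.add_const 1)))

lemma powProdDeriv_mul (k : ℕ) (p q : ℂ) {a A B : ℝ} (ha : 0 < a) (hA : 0 < A) (hB : 0 < B) :
    powProdDeriv k p q (a * A) (a * B) = (a : ℂ) ^ (-(p + q + k)) * powProdDeriv k p q A B := by
  induction k generalizing p q with
  | zero =>
    have ha' : (a : ℂ) ≠ 0 := by exact_mod_cast ha.ne'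
    simp only [powProdDeriv, ofReal_mul]
    rw [mul_cpow_ofReal_nonneg ha.le hA.le, mul_cpow_ofReal_nonneg ha.le hB.le,
      show -(p + q + ((0 : ℕ) : ℂ)) = -p + -q by push_cast; ring, cpow_add _ _ ha']
    ring
  | succ k ih =>
    simp only [powProdDeriv, ih]
    rw [show -(p + 1 + q + (k : ℂ)) = -(p + q + ((k + 1 : ℕ) : ℂ)) by push_cast; ring,
      show -(p + (q + 1) + (k : ℂ)) = -(p + q + ((k + 1 : ℕ) : ℂ)) by push_cast; ring]
    ring

lemma powProdDeriv_succ_zero_zero (k : ℕ) (A B : ℝ) : powProdDeriv (k + 1) 0 0 A B = 0 := by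
  simp [powProdDeriv]

lemma rpow_le_rpow_of_mem_Icc {L R x r : ℝ} (hx : 0 < x) (hxL : x ≤ L) (hxL' : x⁻¹ ≤ L)
    (hr : |r| ≤ R) (hL : 1 ≤ L) : x ^ r ≤ L ^ R := by
  refine le_trans ?_ (Real.rpow_le_rpow_of_exponent_le hL hr)
  rcases le_total 0 r with h | h
  · rw [abs_of_nonneg h]; exact Real.rpow_le_rpow hx.le hxL h
  · rw [abs_of_nonpos h, ← inv_inv x, Real.inv_rpow (by positivity),
      ← Real.rpow_neg (by positivity)]
    exact Real.rpow_le_rpow (by positivity) hxL' (by linarith)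

lemma exists_norm_cpow_le {c C : ℝ} (hc : 0 < c) (R : ℝ) :
    ∃ K, 0 ≤ K ∧ ∀ p : ℂ, ‖p‖ ≤ R → ∀ w A : ℝ, 0 < w → c * w ≤ A → A ≤ C * w →
      ‖(A : ℂ) ^ (-p)‖ ≤ K * w ^ (-p.re) := by
  refine ⟨(max (max C c⁻¹) 1) ^ R, by positivity, fun p hp w A hw h1 h2 => ?_⟩
  have hA : 0 < A := lt_of_lt_of_le (by positivity) h1
  rw [norm_cpow_eq_rpow_re_of_pos hA, neg_re]
  have hAw : A = A / w * w := by field_simp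
  conv_lhs => rw [hAw, Real.mul_rpow (by positivity) hw.le]
  gcongr
  apply rpow_le_rpow_of_mem_Icc (by positivity)
  · exact le_trans ((div_le_iff₀ hw).2 h2) (le_trans (le_max_left _ _) (le_max_left _ _))
  · refine le_trans ?_ (le_trans (le_max_right _ _) (le_max_left _ _))
    exact inv_anti₀ hc ((le_div_iff₀ hw).2 h1)
  · rw [abs_neg]; exact (abs_re_le_norm p).trans hp
  · exact le_max_right _ _

lemma exists_norm_powProdDeriv_le {c C : ℝ} (hc : 0 < c) (k : ℕ) (R : ℝ) :
    ∃ K, 0 ≤ K ∧ ∀ p q : ℂ, ‖p‖ ≤ R → ‖q‖ ≤ R → ∀ w A B : ℝ, 0 < w → c * w ≤ A → A ≤ C * w →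
      c * w ≤ B → B ≤ C * w →
      ‖powProdDeriv k p q A B‖ ≤ K * w ^ (-(p.re + q.re + k)) := by
  induction k generalizing R with
  | zero =>
    obtain ⟨K, hK, h⟩ := exists_norm_cpow_le (C := C) hc R
    refine ⟨K * K, by positivity, fun p q hp hq w A B hw h1 h2 h3 h4 => ?_⟩
    simp only [powProdDeriv, norm_mul]
    rw [show -(p.re + q.re + ((0 : ℕ) : ℝ)) = -p.re + -q.re by push_cast; ring, Real.rpow_add hw]
    calc _ ≤ (K * w ^ (-p.re)) * (K * w ^ (-q.re)) :=
          mul_le_mul (h p hp w A hw h1 h2) (h q hq w B hw h3 h4) (norm_nonneg _) (by positivity)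
      _ = _ := by ring
  | succ k ih =>
    obtain ⟨K, hK, h⟩ := ih (R + 1)
    refine ⟨|R| * K + |R| * K, by positivity, fun p q hp hq w A B hw h1 h2 h3 h4 => ?_⟩
    have hp1 : ‖p + 1‖ ≤ R + 1 := (norm_add_le _ _).trans (by simpa using hp)
    have hq1 : ‖q + 1‖ ≤ R + 1 := (norm_add_le _ _).trans (by simpa using hq)
    have e1 := h (p + 1) q hp1 (by linarith) w A B hw h1 h2 h3 h4
    have e2 := h p (q + 1) (by linarith) hq1 w A B hw h1 h2 h3 h4
    simp only [add_re, one_re] at e1 e2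
    rw [show -(p.re + 1 + q.re + (k : ℝ)) = -(p.re + q.re + ((k + 1 : ℕ) : ℝ)) by
      push_cast; ring] at e1
    rw [show -(p.re + (q.re + 1) + (k : ℝ)) = -(p.re + q.re + ((k + 1 : ℕ) : ℝ)) by
      push_cast; ring] at e2
    simp only [powProdDeriv]
    refine (norm_sub_le _ _).trans ?_
    rw [norm_mul, norm_mul, norm_neg, add_mul, mul_assoc]
    gcongr
    · exact hp.trans (le_abs_self R)
    · exact hq.trans (le_abs_self R)

/-- The Euler–Maclaurin remainder of order `N` at `y` of a function `g 0`, whose successive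
derivatives are the `g k`. -/
noncomputable def eulerMaclaurinRem (N : ℕ) (g : ℕ → ℝ → ℂ) (y : ℝ) : ℂ :=
  g 0 y - ∑ k ∈ Finset.range N, ((bernoulliFun k y / k.factorial : ℝ) : ℂ) * ∫ t in (0:ℝ)..1, g k t

lemma hasDerivAt_bernoulliFun_div_factorial (k : ℕ) (t : ℝ) :
    HasDerivAt (fun u => ((bernoulliFun (k + 1) u / (k + 1).factorial : ℝ) : ℂ))
      ((bernoulliFun k t / k.factorial : ℝ) : ℂ) t := by
  have h := ((hasDerivAt_bernoulliFun (k + 1) t).div_const ((k + 1).factorial : ℝ)).ofReal_comp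
  convert h using 2
  rw [Nat.add_sub_cancel, Nat.factorial_succ]
  push_cast
  have : (k.factorial : ℝ) ≠ 0 := by positivity
  field_simp

lemma norm_le_of_integral_eq_zero {f f' : ℝ → ℂ} {M : ℝ}
    (hf : ∀ t ∈ Icc (0:ℝ) 1, HasDerivAt f (f' t) t) (hM : ∀ t ∈ Icc (0:ℝ) 1, ‖f' t‖ ≤ M)
    (h0 : ∫ t in (0:ℝ)..1, f t = 0) {y : ℝ} (hy : y ∈ Icc (0:ℝ) 1) : ‖f y‖ ≤ M := by
  have hcont : ContinuousOn f (uIcc 0 1) := by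
    rw [uIcc_of_le zero_le_one]
    exact fun t ht => (hf t ht).continuousAt.continuousWithinAt
  have hM0 : 0 ≤ M := (norm_nonneg _).trans (hM y hy)
  have key : f y = ∫ t in (0:ℝ)..1, (f y - f t) := by
    rw [intervalIntegral.integral_sub (by simp) hcont.intervalIntegrable, h0]
    simp
  rw [key]
  have := intervalIntegral.norm_integral_le_of_norm_le_const (a := (0:ℝ)) (b := 1) (C := M)
    (f := fun t => f y - f t) (fun t ht => ?_)
  · simpa using this
  · rw [uIoc_of_le zero_le_one] at ht
    have ht' : t ∈ Icc (0:ℝ) 1 := ⟨ht.1.le, ht.2⟩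
    have := (convex_Icc (0:ℝ) 1).norm_image_sub_le_of_norm_hasDerivWithin_le
      (fun u hu => (hf u hu).hasDerivWithinAt) hM ht' hy
    refine this.trans (mul_le_of_le_one_right hM0 ?_)
    rw [Real.norm_eq_abs, abs_le]
    constructor <;> linarith [hy.1, hy.2, ht'.1, ht'.2]

lemma integral_bernoulliFun_div_factorial (k : ℕ) :
    ∫ t in (0:ℝ)..1, ((bernoulliFun k t / k.factorial : ℝ) : ℂ) = if k = 0 then 1 else 0 := by
  rw [intervalIntegral.integral_ofReal, intervalIntegral.integral_div, integral_bernoulliFun]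
  split_ifs with h <;> simp [h]

lemma continuous_bernoulliFun_div_factorial (k : ℕ) :
    Continuous (fun t => ((bernoulliFun k t / k.factorial : ℝ) : ℂ)) :=
  continuous_ofReal.comp ((continuous_bernoulliFun k).div_const _)

lemma integral_eulerMaclaurinRem_succ (N : ℕ) {g : ℕ → ℝ → ℂ}
    (hg : ContinuousOn (g 0) (Icc 0 1)) :
    ∫ y in (0:ℝ)..1, eulerMaclaurinRem (N + 1) g y = 0 := by
  have hg' : IntervalIntegrable (g 0) volume 0 1 := by
    apply ContinuousOn.intervalIntegrable; rwa [uIcc_of_le zero_le_one]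
  simp only [eulerMaclaurinRem]
  have hi : ∀ k : ℕ, IntervalIntegrable (fun y => ((bernoulliFun k y / k.factorial : ℝ) : ℂ) *
      ∫ t in (0:ℝ)..1, g k t) volume 0 1 := fun k =>
    ((continuous_bernoulliFun_div_factorial k).mul continuous_const).intervalIntegrable _ _
  rw [intervalIntegral.integral_sub hg' (by
      simpa only [Finset.sum_fn] using
        IntervalIntegrable.sum (Finset.range (N + 1)) (fun k _ => hi k)),
    intervalIntegral.integral_finsetSum (fun k _ => hi k)]
  simp_rw [intervalIntegral.integral_mul_const, integral_bernoulliFun_div_factorial]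
  rw [Finset.sum_range_succ']
  simp

lemma hasDerivAt_eulerMaclaurinRem_succ (N : ℕ) {g : ℕ → ℝ → ℂ} {t : ℝ}
    (hg : HasDerivAt (g 0) (g 1 t) t) :
    HasDerivAt (eulerMaclaurinRem (N + 1) g) (eulerMaclaurinRem N (fun k => g (k + 1)) t) t := by
  have h : HasDerivAt (fun y => ∑ k ∈ Finset.range N,
      ((bernoulliFun (k + 1) y / (k + 1).factorial : ℝ) : ℂ) * ∫ t in (0:ℝ)..1, g (k + 1) t)
      (∑ k ∈ Finset.range N,
      ((bernoulliFun k t / k.factorial : ℝ) : ℂ) * ∫ t in (0:ℝ)..1, g (k + 1) t) t :=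
    HasDerivAt.fun_sum fun k _ => (hasDerivAt_bernoulliFun_div_factorial k t).mul_const _
  refine ((hg.sub h).sub_const (∫ t in (0:ℝ)..1, g 0 t)).congr_of_eventuallyEq
    (Eventually.of_forall fun y => ?_)
  simp only [eulerMaclaurinRem, Finset.sum_range_succ', bernoulliFun_zero, Pi.sub_apply]
  simp
  ring

lemma norm_eulerMaclaurinRem_le (N : ℕ) {g : ℕ → ℝ → ℂ} {M : ℝ}
    (hg : ∀ k, ∀ t ∈ Icc (0:ℝ) 1, HasDerivAt (g k) (g (k + 1) t) t)
    (hM : ∀ t ∈ Icc (0:ℝ) 1, ‖g N t‖ ≤ M) {y : ℝ} (hy : y ∈ Icc (0:ℝ) 1) :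
    ‖eulerMaclaurinRem N g y‖ ≤ M := by
  induction N generalizing g y with
  | zero => simpa [eulerMaclaurinRem] using hM y hy
  | succ N ih =>
    exact norm_le_of_integral_eq_zero
      (fun t ht => hasDerivAt_eulerMaclaurinRem_succ N (hg 0 t ht))
      (fun t ht => ih (fun k => hg (k + 1)) hM ht)
      (integral_eulerMaclaurinRem_succ N
        fun t ht => (hg 0 t ht).continuousAt.continuousWithinAt) hy

lemma eulerMaclaurinRem_succ_eq (N : ℕ) {g : ℕ → ℝ → ℂ}
    (hg : ∀ k, ∀ t ∈ Icc (0:ℝ) 1, HasDerivAt (g k) (g (k + 1) t) t) (y : ℝ) :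
    eulerMaclaurinRem (N + 1) g y = g 0 y - (∫ t in (0:ℝ)..1, g 0 t) -
      ∑ k ∈ Finset.range N, ((bernoulliFun (k + 1) y / (k + 1).factorial : ℝ) : ℂ) *
        (g k 1 - g k 0) := by
  have h : ∀ k, ∫ t in (0:ℝ)..1, g (k + 1) t = g k 1 - g k 0 := fun k => by
    apply intervalIntegral.integral_eq_sub_of_hasDerivAt
    · rw [uIcc_of_le zero_le_one]; exact hg k
    · apply ContinuousOn.intervalIntegrable
      rw [uIcc_of_le zero_le_one]
      exact fun t ht => (hg (k + 1) t ht).continuousAt.continuousWithinAt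
  simp only [eulerMaclaurinRem, Finset.sum_range_succ', h, bernoulliFun_zero]
  simp
  ring

lemma powProdDeriv_zero_eq_cexp (s : ℂ) {A B : ℝ} (hA : 0 < A) (hB : 0 < B) :
    powProdDeriv 0 s s A B = cexp (s * (-Real.log (A * B) : ℝ)) := by
  have hA' : (A : ℂ) ≠ 0 := by exact_mod_cast hA.ne'
  have hB' : (B : ℂ) ≠ 0 := by exact_mod_cast hB.ne'
  simp only [powProdDeriv]
  rw [cpow_def_of_ne_zero hA', cpow_def_of_ne_zero hB', ← Complex.exp_add,
    Real.log_mul hA.ne' hB.ne', ← ofReal_log hA.le, ← ofReal_log hB.le]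
  push_cast
  ring_nf

lemma continuousOn_log_mul {A B : ℝ} (hA : 0 < A) (hB : 0 < B) :
    ContinuousOn (fun t : ℝ => -Real.log ((A + t) * (B + t))) (Ici 0) := by
  refine (ContinuousOn.log (by fun_prop) fun t ht => ?_).neg
  have ht' : 0 ≤ t := ht
  positivity

lemma differentiable_integral_powProdDeriv {A B : ℝ} (hA : 0 < A) (hB : 0 < B) :
    Differentiable ℂ (fun s => ∫ t in (0:ℝ)..1, powProdDeriv 0 s s (A + t) (B + t)) := by
  set μ : Measure ℝ := volume.restrict (Ioc 0 1)
  set X : ℝ → ℝ := fun t => -Real.log ((A + t) * (B + t))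
  have hX : ContinuousOn X (Icc 0 1) := (continuousOn_log_mul hA hB).mono Icc_subset_Ici_self
  have hset : ProbabilityTheory.integrableExpSet X μ = univ := by
    refine eq_univ_of_forall fun r => ?_
    exact ((continuousOn_const.mul hX).rexp.integrableOn_Icc).mono_set Ioc_subset_Icc_self
  have h := ProbabilityTheory.differentiableOn_complexMGF (X := X) (μ := μ)
  simp only [hset, interior_univ, mem_univ, ofPred_true, differentiableOn_univ] at h
  convert h using 2 with s
  rw [ProbabilityTheory.complexMGF, intervalIntegral.integral_of_le zero_le_one]
  refine setIntegral_congr_fun measurableSet_Ioc fun t ht => ?_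
  exact powProdDeriv_zero_eq_cexp s (by linarith [ht.1]) (by linarith [ht.1])

lemma integrableOn_exp_log_mul {A B : ℝ} (hA : 0 < A) (hB : 0 < B) {r : ℝ} (hr : 1 / 2 < r) :
    IntegrableOn (fun t : ℝ => Real.exp (r * -Real.log ((A + t) * (B + t)))) (Ioi 0) := by
  have hm : 0 < min A B := lt_min hA hB
  refine Integrable.mono' (integrableOn_add_rpow_Ioi_of_lt (a := -(2 * r)) (c := 0) (m := min A B)
    (by linarith) (by linarith)) ?_ ?_
  · exact ((continuousOn_const.mul ((continuousOn_log_mul hA hB).mono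
      Ioi_subset_Ici_self)).rexp).aestronglyMeasurable measurableSet_Ioi
  · refine (ae_restrict_iff' measurableSet_Ioi).2 (Eventually.of_forall fun t ht => ?_)
    have ht' : 0 < t := ht
    have h1 : 0 < t + min A B := by positivity
    rw [Real.norm_eq_abs, abs_of_pos (Real.exp_pos _), Real.rpow_def_of_pos h1]
    apply Real.exp_le_exp.2
    rw [Real.log_mul (by positivity) (by positivity)]
    have e1 := Real.log_le_log h1 (by linarith [min_le_left A B] : t + min A B ≤ A + t)
    have e2 := Real.log_le_log h1 (by linarith [min_le_right A B] : t + min A B ≤ B + t)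
    nlinarith

lemma integrableOn_powProdDeriv {A B : ℝ} (hA : 0 < A) (hB : 0 < B) {s : ℂ} (hs : 1 / 2 < s.re) :
    IntegrableOn (fun t : ℝ => powProdDeriv 0 s s (A + t) (B + t)) (Ioi 0) := by
  have h := integrableOn_exp_log_mul hA hB hs
  refine Integrable.mono' h ?_ ?_
  · refine ContinuousOn.aestronglyMeasurable (fun t ht => ?_) measurableSet_Ioi
    have ht' : 0 < t := ht
    exact (hasDerivAt_powProdDeriv 0 s s (by positivity)
      (by positivity)).continuousAt.continuousWithinAt
  · refine (ae_restrict_iff' measurableSet_Ioi).2 (Eventually.of_forall fun t ht => ?_)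
    have ht' : 0 < t := ht
    rw [powProdDeriv_zero_eq_cexp s (by positivity) (by positivity), norm_exp, re_mul_ofReal]

lemma analyticAt_integral_Ioi_powProdDeriv {A B : ℝ} (hA : 0 < A) (hB : 0 < B) {s : ℂ}
    (hs : 1 / 2 < s.re) :
    AnalyticAt ℂ (fun s => ∫ t in Ioi (0:ℝ), powProdDeriv 0 s s (A + t) (B + t)) s := by
  set μ : Measure ℝ := volume.restrict (Ioi 0)
  set X : ℝ → ℝ := fun t => -Real.log ((A + t) * (B + t))
  have hset : s.re ∈ interior (ProbabilityTheory.integrableExpSet X μ) :=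
    interior_maximal (t := Ioi (1 / 2 : ℝ))
      (fun r (hr : 1 / 2 < r) => integrableOn_exp_log_mul hA hB hr) isOpen_Ioi hs
  have e : (fun s => ∫ t in Ioi (0:ℝ), powProdDeriv 0 s s (A + t) (B + t)) =
      ProbabilityTheory.complexMGF X μ := funext fun z =>
    setIntegral_congr_fun measurableSet_Ioi fun t (ht : 0 < t) =>
      powProdDeriv_zero_eq_cexp z (by positivity) (by positivity)
  rw [e]
  exact ProbabilityTheory.analyticAt_complexMGF hset

/-- The shifts `α i + t`, `β i + t` with `t ∈ [0, 1]` are comparable to the weight `w i ≥ 1`, and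
`∑ i, w i ^ (-r)` converges for `r > d`. -/
structure IsComparableFamily {ι : Type*} (α β w : ι → ℝ) (c C d : ℝ) : Prop where
  pos : 0 < c
  one_le : ∀ i, 1 ≤ w i
  left_ge : ∀ i, ∀ t ∈ Icc (0:ℝ) 1, c * w i ≤ α i + t
  left_le : ∀ i, ∀ t ∈ Icc (0:ℝ) 1, α i + t ≤ C * w i
  right_ge : ∀ i, ∀ t ∈ Icc (0:ℝ) 1, c * w i ≤ β i + t
  right_le : ∀ i, ∀ t ∈ Icc (0:ℝ) 1, β i + t ≤ C * w i
  summable : ∀ r, d < r → Summable (fun i => w i ^ (-r))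

namespace IsComparableFamily

variable {ι : Type*} {α β w : ι → ℝ} {c C d : ℝ}

lemma left_pos (h : IsComparableFamily α β w c C d) (i : ι) {t : ℝ} (ht : t ∈ Icc (0:ℝ) 1) :
    0 < α i + t :=
  lt_of_lt_of_le (mul_pos h.pos (by linarith [h.one_le i])) (h.left_ge i t ht)

lemma right_pos (h : IsComparableFamily α β w c C d) (i : ι) {t : ℝ} (ht : t ∈ Icc (0:ℝ) 1) :
    0 < β i + t :=
  lt_of_lt_of_le (mul_pos h.pos (by linarith [h.one_le i])) (h.right_ge i t ht)

lemma exists_bound (h : IsComparableFamily α β w c C d) (k : ℕ) (R : ℝ) :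
    ∃ K, ∀ s : ℂ, ‖s‖ ≤ R → ∀ r, r ≤ 2 * s.re + k → ∀ i, ∀ t ∈ Icc (0:ℝ) 1,
      ‖powProdDeriv k s s (α i + t) (β i + t)‖ ≤ K * w i ^ (-r) := by
  obtain ⟨K, hK, hb⟩ := exists_norm_powProdDeriv_le (C := C) h.pos k R
  refine ⟨K, fun s hs r hr i t ht => ?_⟩
  have hw := h.one_le i
  refine (hb s s hs hs (w i) _ _ (by linarith) (h.left_ge i t ht) (h.left_le i t ht)
    (h.right_ge i t ht) (h.right_le i t ht)).trans ?_
  gcongr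
  linarith

lemma hasDerivAt (h : IsComparableFamily α β w c C d) (s : ℂ) (i : ι) (k : ℕ) (t : ℝ)
    (ht : t ∈ Icc (0:ℝ) 1) :
    HasDerivAt (fun u => powProdDeriv k s s (α i + u) (β i + u))
      (powProdDeriv (k + 1) s s (α i + t) (β i + t)) t :=
  hasDerivAt_powProdDeriv k s s (h.left_pos i ht) (h.right_pos i ht)

lemma summable_norm_powProdDeriv (h : IsComparableFamily α β w c C d) (k : ℕ) {s : ℂ}
    (hs : d < 2 * s.re + k) {t : ℝ} (ht : t ∈ Icc (0:ℝ) 1) :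
    Summable (fun i => ‖powProdDeriv k s s (α i + t) (β i + t)‖) := by
  obtain ⟨K, hK⟩ := h.exists_bound k ‖s‖
  exact Summable.of_nonneg_of_le (fun _ => norm_nonneg _)
    (fun i => hK s le_rfl _ le_rfl i t ht) ((h.summable _ hs).mul_left K)

lemma summable_integral (h : IsComparableFamily α β w c C d) {s : ℂ} (hs : d < 2 * s.re) :
    Summable (fun i => ∫ t in (0:ℝ)..1, powProdDeriv 0 s s (α i + t) (β i + t)) := by
  obtain ⟨K, hK⟩ := h.exists_bound 0 ‖s‖
  refine Summable.of_norm_bounded ((h.summable _ hs).mul_left K) fun i => ?_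
  have := intervalIntegral.norm_integral_le_of_norm_le_const (a := (0:ℝ)) (b := 1)
    (C := K * w i ^ (-(2 * s.re))) (f := fun t => powProdDeriv 0 s s (α i + t) (β i + t))
    (fun t ht => ?_)
  · simpa using this
  · rw [uIoc_of_le zero_le_one] at ht
    exact hK s le_rfl _ (by simp) i t ⟨ht.1.le, ht.2⟩

/-- The sum of the Euler–Maclaurin remainders of order `N` of the functions
`t ↦ ((α i + t) * (β i + t)) ^ (-s)`. -/
noncomputable def remSum (α β : ι → ℝ) (N : ℕ) (y : ℝ) (s : ℂ) : ℂ :=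
  ∑' i, eulerMaclaurinRem N (fun k t => powProdDeriv k s s (α i + t) (β i + t)) y

lemma differentiable_eulerMaclaurinRem (h : IsComparableFamily α β w c C d) (N : ℕ) {y : ℝ}
    (hy : y ∈ Icc (0:ℝ) 1) (i : ι) : Differentiable ℂ (fun s =>
      eulerMaclaurinRem (N + 1) (fun k t => powProdDeriv k s s (α i + t) (β i + t)) y) := by
  have h0 : (0:ℝ) ∈ Icc (0:ℝ) 1 := by simp
  have h1 : (1:ℝ) ∈ Icc (0:ℝ) 1 := by simp
  have hd : ∀ (k : ℕ) (t : ℝ), t ∈ Icc (0:ℝ) 1 →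
      Differentiable ℂ (fun s => powProdDeriv k s s (α i + t) (β i + t)) := fun k t ht =>
    differentiable_powProdDeriv k differentiable_id differentiable_id (h.left_pos i ht)
      (h.right_pos i ht)
  have e : (fun s => eulerMaclaurinRem (N + 1)
      (fun k t => powProdDeriv k s s (α i + t) (β i + t)) y) = _ :=
    funext fun s => eulerMaclaurinRem_succ_eq N (fun k t ht => h.hasDerivAt s i k t ht) y
  rw [e]
  refine ((hd 0 y hy).sub ?_).sub (Differentiable.fun_sum fun k _ =>
    ((hd k 1 h1).sub (hd k 0 h0)).const_mul _)
  have p1 := h.left_pos i h0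
  have p2 := h.right_pos i h0
  rw [add_zero] at p1 p2
  exact differentiable_integral_powProdDeriv p1 p2

lemma exists_rem_bound (h : IsComparableFamily α β w c C d) (N : ℕ) (R : ℝ) {y : ℝ}
    (hy : y ∈ Icc (0:ℝ) 1) :
    ∃ K, ∀ s : ℂ, ‖s‖ ≤ R → ∀ r, r ≤ 2 * s.re + N → ∀ i,
      ‖eulerMaclaurinRem N (fun k t => powProdDeriv k s s (α i + t) (β i + t)) y‖
        ≤ K * w i ^ (-r) := by
  obtain ⟨K, hK⟩ := h.exists_bound N R
  exact ⟨K, fun s hs r hr i => norm_eulerMaclaurinRem_le N (h.hasDerivAt s i)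
    (fun t ht => hK s hs r hr i t ht) hy⟩

lemma differentiableOn_remSum (h : IsComparableFamily α β w c C d) (N : ℕ) {y : ℝ}
    (hy : y ∈ Icc (0:ℝ) 1) :
    DifferentiableOn ℂ (remSum α β (N + 1) y) {s | d < 2 * s.re + (N + 1 : ℕ)} := by
  intro s₀ hs₀
  have hs₀' : d < 2 * s₀.re + (N + 1 : ℕ) := hs₀
  set η : ℝ := (2 * s₀.re + (N + 1 : ℕ) - d) / 4 with hη
  have hη0 : 0 < η := by rw [hη]; linarith
  obtain ⟨K, hK⟩ := h.exists_rem_bound (N + 1) (‖s₀‖ + η) hy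
  have hd : DifferentiableOn ℂ (remSum α β (N + 1) y) (Metric.ball s₀ η) := by
    refine differentiableOn_tsum_of_summable_norm
      ((h.summable (2 * s₀.re + (N + 1 : ℕ) - 2 * η) (by rw [hη]; linarith)).mul_left K)
      (fun i => (h.differentiable_eulerMaclaurinRem N hy i).differentiableOn) Metric.isOpen_ball
      fun i s hs => ?_
    have hs' : ‖s - s₀‖ < η := by simpa [dist_eq_norm] using hs
    refine hK s ?_ _ ?_ i
    · calc ‖s‖ = ‖s₀ + (s - s₀)‖ := by ring_nf
        _ ≤ _ := (norm_add_le _ _).trans (by linarith)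
    · have := (abs_re_le_norm (s - s₀)).trans_lt hs'
      rw [sub_re, abs_lt] at this
      linarith [this.1]
  exact (hd.differentiableAt (Metric.ball_mem_nhds s₀ hη0)).differentiableWithinAt

lemma analyticAt_remSum (h : IsComparableFamily α β w c C d) (N : ℕ) {y : ℝ}
    (hy : y ∈ Icc (0:ℝ) 1) {s : ℂ} (hs : d < 2 * s.re + (N + 1 : ℕ)) :
    AnalyticAt ℂ (remSum α β (N + 1) y) s :=
  (h.differentiableOn_remSum N hy).analyticAt
    ((isOpen_lt continuous_const (by fun_prop)).mem_nhds hs)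

lemma remSum_zero (h : IsComparableFamily α β w c C d) (N : ℕ) (y : ℝ) :
    remSum α β (N + 1) y 0 = 0 := by
  have : ∀ i, eulerMaclaurinRem (N + 1)
      (fun k t => powProdDeriv k 0 0 (α i + t) (β i + t)) y = 0 := fun i => by
    rw [eulerMaclaurinRem_succ_eq N (h.hasDerivAt 0 i)]
    have : ∀ k : ℕ, powProdDeriv k 0 0 (α i + 1) (β i + 1)
        - powProdDeriv k 0 0 (α i + 0) (β i + 0) = 0 := fun k => by
      cases k with
      | zero => simp [powProdDeriv]
      | succ k => simp [powProdDeriv_succ_zero_zero]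
    simp only [this]
    simp [powProdDeriv]
  simp [remSum, this]

lemma tsum_eq_remSum_add (h : IsComparableFamily α β w c C d) (N : ℕ) {y : ℝ}
    (hy : y ∈ Icc (0:ℝ) 1) {s : ℂ} (hs : d < 2 * s.re) :
    ∑' i, powProdDeriv 0 s s (α i + y) (β i + y) = remSum α β (N + 1) y s +
      ∑' i, (∫ t in (0:ℝ)..1, powProdDeriv 0 s s (α i + t) (β i + t)) +
      ∑ k ∈ Finset.range N, ((bernoulliFun (k + 1) y / (k + 1).factorial : ℝ) : ℂ) *
        ∑' i, (powProdDeriv k s s (α i + 1) (β i + 1) -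
          powProdDeriv k s s (α i + 0) (β i + 0)) := by
  have h0 : (0:ℝ) ∈ Icc (0:ℝ) 1 := by simp
  have h1 : (1:ℝ) ∈ Icc (0:ℝ) 1 := by simp
  have hk : ∀ k : ℕ, d < 2 * s.re + k := fun k => lt_of_lt_of_le hs (by simp)
  obtain ⟨K, hK⟩ := h.exists_rem_bound (N + 1) ‖s‖ hy
  have hr : Summable fun i => eulerMaclaurinRem (N + 1)
      (fun k t => powProdDeriv k s s (α i + t) (β i + t)) y :=
    Summable.of_norm_bounded ((h.summable _ (hk (N + 1))).mul_left K)
      fun i => hK s le_rfl _ le_rfl i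
  have hdiff : ∀ k, Summable fun i => (powProdDeriv k s s (α i + 1) (β i + 1) -
      powProdDeriv k s s (α i + 0) (β i + 0)) := fun k =>
    (h.summable_norm_powProdDeriv k (hk k) h1).of_norm.sub
      (h.summable_norm_powProdDeriv k (hk k) h0).of_norm
  have hsum := (hr.hasSum.add (h.summable_integral hs).hasSum).add
    (hasSum_sum fun k (_ : k ∈ Finset.range N) => (hdiff k).hasSum.mul_left
      ((bernoulliFun (k + 1) y / (k + 1).factorial : ℝ) : ℂ))
  refine (hsum.congr_fun fun i => ?_).tsum_eq
  rw [eulerMaclaurinRem_succ_eq N (h.hasDerivAt s i)]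
  ring

end IsComparableFamily

open HurwitzZeta in
lemma meromorphicAt_hurwitzZeta (a : UnitAddCircle) (s : ℂ) :
    MeromorphicAt (hurwitzZeta a) s := by
  have hne : ∀ z : ℂ, z ≠ 1 → DifferentiableAt ℂ (hurwitzZeta a) z :=
    fun z hz => differentiableAt_hurwitzZeta a hz
  by_cases hs : s = 1
  · subst hs
    have h1 : Differentiable ℂ (fun s ↦ hurwitzZeta a s - 1 / (s - 1) / Gammaℝ s) := by
      intro z
      by_cases hz : z = 1
      · subst hz; exact differentiableAt_hurwitzZeta_sub_one_div a
      · refine (hne z hz).sub ?_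
        have h3 : DifferentiableAt ℂ (fun s : ℂ => (s - 1)⁻¹) z :=
          DifferentiableAt.fun_inv (by fun_prop) (sub_ne_zero.2 hz)
        simp only [div_eq_mul_inv]
        exact ((differentiableAt_const _).mul h3).mul
          differentiable_Gammaℝ_inv.differentiableAt
    have h2 : MeromorphicAt (fun s : ℂ ↦ 1 / (s - 1) / Gammaℝ s) 1 := by
      simp only [div_eq_mul_inv]
      have h3 : MeromorphicAt (fun s : ℂ => (Gammaℝ s)⁻¹) 1 :=
        (differentiable_Gammaℝ_inv.analyticAt 1).meromorphicAt
      have h4 : MeromorphicAt (fun s : ℂ => (s - 1)⁻¹) 1 := by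
        refine MeromorphicAt.inv (AnalyticAt.meromorphicAt ?_)
        fun_prop
      exact ((MeromorphicAt.const 1 1).mul h4).mul h3
    exact ((h1.analyticAt 1).meromorphicAt.add h2).congr
      (Eventually.of_forall fun z => by simp)
  · refine (DifferentiableOn.analyticAt (s := {1}ᶜ) (fun z hz => ?_) ?_).meromorphicAt
    · exact (hne z hz).differentiableWithinAt
    · exact isOpen_compl_singleton.mem_nhds hs

lemma powProdDeriv_zero_self (s : ℂ) {a : ℝ} (ha : 0 < a) :
    powProdDeriv 0 s s a a = 1 / (a : ℂ) ^ (2 * s) := by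
  have ha' : (a : ℂ) ≠ 0 := by exact_mod_cast ha.ne'
  rw [powProdDeriv, ← cpow_add _ _ ha', one_div, ← cpow_neg]
  ring_nf

lemma tsum_succ_sub_eq_neg {u : ℕ → ℂ} (hu : Summable u) : ∑' n, (u (n + 1) - u n) = -u 0 := by
  rw [((summable_nat_add_iff 1).2 hu).tsum_sub hu, hu.tsum_eq_zero_add]
  ring

lemma isComparableFamily_nat_add_one :
    IsComparableFamily (fun n : ℕ => (n + 1 : ℝ)) (fun n : ℕ => (n + 1 : ℝ))
      (fun n : ℕ => (n + 1 : ℝ)) 1 2 1 where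
  pos := one_pos
  one_le n := by simp
  left_ge n t ht := by linarith [ht.1]
  left_le n t ht := by linarith [ht.2, (Nat.cast_nonneg n : (0:ℝ) ≤ n)]
  right_ge n t ht := by linarith [ht.1]
  right_le n t ht := by linarith [ht.2, (Nat.cast_nonneg n : (0:ℝ) ≤ n)]
  summable r hr := by
    simpa using (summable_nat_add_iff 1).2 (Real.summable_nat_rpow.2 (by linarith : -r < -1))

open HurwitzZeta in
/-- The value of the Hurwitz zeta function at `0`. -/
lemma hurwitzZeta_apply_zero {x : ℝ} (hx : x ∈ Ioc (0:ℝ) 1) :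
    hurwitzZeta x 0 = 1 / 2 - x := by
  have hF := isComparableFamily_nat_add_one
  have hx' : x ∈ Icc (0:ℝ) 1 := ⟨hx.1.le, hx.2⟩
  have h1 : (1:ℝ) ∈ Icc (0:ℝ) 1 := by simp
  have h0 : (0:ℝ) ∈ Icc (0:ℝ) 1 := by simp
  set R : ℝ → ℂ → ℂ := fun y => IsComparableFamily.remSum (fun n : ℕ => (n + 1 : ℝ))
    (fun n : ℕ => (n + 1 : ℝ)) 2 y with hR
  have hz : ∀ y ∈ Ioc (0:ℝ) 1, ∀ s : ℂ, 1 < s.re →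
      ∑' n : ℕ, powProdDeriv 0 s s ((n + 1 : ℝ) + y) ((n + 1 : ℝ) + y) =
        hurwitzZeta y (2 * s) - 1 / (y : ℂ) ^ (2 * s) := by
    intro y hy s hs
    have h2 : 1 < (2 * s).re := by simp; linarith
    have := hasSum_hurwitzZeta_of_one_lt_re ⟨hy.1.le, hy.2⟩ h2
    rw [← this.tsum_eq, this.summable.tsum_eq_zero_add]
    simp only [Nat.cast_zero, zero_add, add_sub_cancel_left]
    refine tsum_congr fun n => ?_
    rw [powProdDeriv_zero_self s (by have := hy.1; positivity)]
    push_cast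
    rfl
  have hdiff : ∀ s : ℂ, 1 < s.re → ∑' n : ℕ, (powProdDeriv 0 s s ((n + 1 : ℝ) + 1) ((n + 1 : ℝ) + 1)
      - powProdDeriv 0 s s ((n + 1 : ℝ) + 0) ((n + 1 : ℝ) + 0)) = -1 := by
    intro s hs
    have := tsum_succ_sub_eq_neg
      (hF.summable_norm_powProdDeriv 0 (s := s) (by simp; linarith) h0).of_norm
    simpa [powProdDeriv] using this
  have key : ∀ s : ℂ, 1 < s.re → (hurwitzZeta x (2 * s) - hurwitzZeta (1:ℝ) (2 * s)) -
      (x : ℂ) ^ (-(2 * s)) + 1 = R x s - R 1 s + (1 - x) := by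
    intro s hs
    have e1 := hF.tsum_eq_remSum_add 1 hx' (s := s) (by linarith)
    have e2 := hF.tsum_eq_remSum_add 1 h1 (s := s) (by linarith)
    rw [hz x hx s hs] at e1
    rw [hz 1 ⟨one_pos, le_rfl⟩ s hs] at e2
    simp only [Finset.sum_range_one, hdiff s hs, zero_add, bernoulliFun_one] at e1 e2
    simp only [hR, cpow_neg]
    push_cast at e1 e2 ⊢
    simp only [one_cpow] at e1 e2
    linear_combination e1 - e2
  have hx0 : (x : ℂ) ≠ 0 := by exact_mod_cast hx.1.ne'
  have hU : IsPreconnected {s : ℂ | -(1/2) < s.re} := (convex_halfSpace_re_gt _).isPreconnected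
  have hL : AnalyticOnNhd ℂ (fun s => (hurwitzZeta x (2 * s) - hurwitzZeta (1:ℝ) (2 * s)) -
      (x : ℂ) ^ (-(2 * s)) + 1) {s : ℂ | -(1/2) < s.re} := by
    refine fun s _ => Differentiable.analyticAt ?_ s
    refine (((differentiable_hurwitzZeta_sub_hurwitzZeta (x : UnitAddCircle) (1:ℝ)).comp
      (differentiable_id.const_mul 2)).sub fun z => ?_).add_const 1
    exact (differentiableAt_id.const_mul 2).neg.const_cpow (Or.inl hx0)
  have hRa : AnalyticOnNhd ℂ (fun s => R x s - R 1 s + (1 - x)) {s : ℂ | -(1/2) < s.re} := by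
    intro s hs
    have hs' : (1:ℝ) < 2 * s.re + (1 + 1 : ℕ) := by
      have : -(1/2) < s.re := hs
      push_cast; linarith
    exact ((hF.analyticAt_remSum 1 hx' hs').sub (hF.analyticAt_remSum 1 h1 hs')).add
      analyticAt_const
  have h2 : (2:ℂ) ∈ {s : ℂ | -(1/2) < s.re} := by simp; norm_num
  have hev := hL.eqOn_of_preconnected_of_eventuallyEq hRa hU h2 (by
    filter_upwards [(isOpen_lt continuous_const continuous_re).mem_nhds
      (show (1:ℝ) < (2:ℂ).re by simp)] with s hs using key s hs)
  have := hev (show (0:ℂ) ∈ {s : ℂ | -(1/2) < s.re} by simp)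
  simp only [hR, hF.remSum_zero 1, mul_zero, neg_zero, cpow_zero] at this
  have hone : hurwitzZeta ((1:ℝ) : UnitAddCircle) 0 = -1/2 := by
    rw [AddCircle.coe_period, hurwitzZeta_zero, riemannZeta_zero]
  rw [hone] at this
  linear_combination this

/-- The meromorphic continuation of `∫ t in Ioi 0, ((A + t) * (B + t)) ^ (-s)` to the half plane
`1 / 2 - m < re s`. -/
noncomputable def integralCont (A B : ℝ) : ℕ → ℂ → ℂ
  | 0, s => ∫ t in Ioi (0:ℝ), powProdDeriv 0 s s (A + t) (B + t)
  | m + 1, s => (2 * s * (((A - B) / 2 : ℝ) : ℂ) ^ 2 * integralCont A B m (s + 1)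
      - ((A + B) / 2 : ℝ) * powProdDeriv 0 s s A B) / (1 - 2 * s)

lemma hasDerivAt_mul_powProdDeriv (s : ℂ) {A B t : ℝ} (hA : 0 < A + t) (hB : 0 < B + t) :
    HasDerivAt (fun u : ℝ => ((((A + B) / 2 + u : ℝ) : ℂ)) * powProdDeriv 0 s s (A + u) (B + u))
      ((1 - 2 * s) * powProdDeriv 0 s s (A + t) (B + t) - 2 * s * (((A - B) / 2 : ℝ) : ℂ) ^ 2 *
        powProdDeriv 0 (s + 1) (s + 1) (A + t) (B + t)) t := by
  have h1 : HasDerivAt (fun u : ℝ => (((A + B) / 2 + u : ℝ) : ℂ)) 1 t := by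
    simpa using ((hasDerivAt_id t).const_add ((A + B) / 2)).ofReal_comp
  refine (h1.mul (hasDerivAt_powProdDeriv 0 s s hA hB)).congr_deriv ?_
  have hA' : ((A + t : ℝ) : ℂ) ≠ 0 := by exact_mod_cast hA.ne'
  have hB' : ((B + t : ℝ) : ℂ) ≠ 0 := by exact_mod_cast hB.ne'
  simp only [powProdDeriv]
  have e1 : ((A + t : ℝ) : ℂ) ^ (-s) = ((A + t : ℝ) : ℂ) ^ (-(s + 1)) * (A + t : ℝ) := by
    conv_lhs => rw [show -s = -(s + 1) + 1 by ring, cpow_add _ _ hA', cpow_one]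
  have e2 : ((B + t : ℝ) : ℂ) ^ (-s) = ((B + t : ℝ) : ℂ) ^ (-(s + 1)) * (B + t : ℝ) := by
    conv_lhs => rw [show -s = -(s + 1) + 1 by ring, cpow_add _ _ hB', cpow_one]
  rw [e1, e2]
  push_cast
  ring

lemma norm_mul_powProdDeriv_le {s : ℂ} (hs : 0 ≤ s.re) {A B t : ℝ} (hA : 0 < A) (hB : 0 < B)
    (ht : 0 ≤ t) :
    ‖((((A + B) / 2 + t : ℝ) : ℂ)) * powProdDeriv 0 s s (A + t) (B + t)‖ ≤
      (A + B) / 2 / min A B * (t + min A B) ^ (-(2 * s.re - 1)) := by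
  have hm : 0 < min A B := lt_min hA hB
  have h1 := min_le_left A B
  have h2 := min_le_right A B
  set m := min A B
  have htm : 0 < t + m := by positivity
  rw [norm_mul, powProdDeriv, norm_mul, norm_cpow_eq_rpow_re_of_pos (by positivity),
    norm_cpow_eq_rpow_re_of_pos (by positivity), norm_real, Real.norm_of_nonneg (by positivity),
    show -(2 * s.re - 1) = 1 + ((-s).re + (-s).re) by simp; ring, Real.rpow_add htm, Real.rpow_one,
    Real.rpow_add htm, ← mul_assoc ((A + B) / 2 / m)]
  have hn : (-s).re ≤ 0 := by simpa
  refine mul_le_mul ?_ (mul_le_mul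
    (Real.rpow_le_rpow_of_nonpos htm (by linarith : t + m ≤ A + t) hn)
    (Real.rpow_le_rpow_of_nonpos htm (by linarith : t + m ≤ B + t) hn)
    (by positivity) (by positivity))
    (by positivity) (by positivity)
  rw [div_mul_eq_mul_div, le_div_iff₀ hm]
  nlinarith

lemma integral_Ioi_powProdDeriv_recursion {A B : ℝ} (hA : 0 < A) (hB : 0 < B) {s : ℂ}
    (hs : 1 / 2 < s.re) : integralCont A B 1 s = integralCont A B 0 s := by
  have hs1 : 1 - 2 * s ≠ 0 := fun h => by
    have := congrArg re h
    simp at this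
    linarith
  have hi := integrableOn_powProdDeriv hA hB hs
  have hi1 := integrableOn_powProdDeriv hA hB (s := s + 1) (by simp; linarith)
  have hlim : Tendsto (fun u : ℝ => ((((A + B) / 2 + u : ℝ) : ℂ)) *
      powProdDeriv 0 s s (A + u) (B + u)) atTop (𝓝 0) := by
    rw [tendsto_zero_iff_norm_tendsto_zero]
    have h0 : Tendsto (fun t : ℝ => (A + B) / 2 / min A B * (t + min A B) ^ (-(2 * s.re - 1)))
        atTop (𝓝 0) := by
      simpa using ((tendsto_rpow_neg_atTop (by linarith : 0 < 2 * s.re - 1)).comp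
        (tendsto_atTop_add_const_right atTop (min A B) tendsto_id)).const_mul
        ((A + B) / 2 / min A B)
    refine squeeze_zero' (Eventually.of_forall fun _ => norm_nonneg _) ?_ h0
    filter_upwards [eventually_ge_atTop 0] with t ht
    exact norm_mul_powProdDeriv_le (by linarith) hA hB ht
  have := integral_Ioi_of_hasDerivAt_of_tendsto'
    (fun t (ht : 0 ≤ t) => hasDerivAt_mul_powProdDeriv s (A := A) (B := B) (t := t)
      (by positivity) (by positivity))
    ((hi.const_mul _).sub (hi1.const_mul _)) hlim
  rw [integral_sub (hi.const_mul _) (hi1.const_mul _), integral_const_mul,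
    integral_const_mul] at this
  simp only [add_zero] at this
  simp only [integralCont]
  rw [div_eq_iff hs1]
  linear_combination -this

lemma integralCont_eq {A B : ℝ} (hA : 0 < A) (hB : 0 < B) (m : ℕ) {s : ℂ}
    (hs : 1 / 2 < s.re) : integralCont A B m s = integralCont A B 0 s := by
  induction m generalizing s with
  | zero => rfl
  | succ m ih =>
    rw [← integral_Ioi_powProdDeriv_recursion hA hB hs, integralCont, integralCont,
      ih (by simp; linarith)]

lemma analyticAt_powProdDeriv (k : ℕ) {A B : ℝ} (hA : 0 < A) (hB : 0 < B) (s : ℂ) :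
    AnalyticAt ℂ (fun s => powProdDeriv k s s A B) s :=
  (differentiable_powProdDeriv k differentiable_id differentiable_id hA hB).analyticAt s

lemma meromorphicAt_integralCont {A B : ℝ} (hA : 0 < A) (hB : 0 < B) (m : ℕ) {s : ℂ}
    (hs : 1 / 2 - m < s.re) : MeromorphicAt (integralCont A B m) s := by
  induction m generalizing s with
  | zero =>
    exact (analyticAt_integral_Ioi_powProdDeriv hA hB (by simpa using hs)).meromorphicAt
  | succ m ih =>
    have h1 : MeromorphicAt (fun z => integralCont A B m (z + 1)) s := by
      refine MeromorphicAt.comp_analyticAt (g := fun z : ℂ => z + 1) (ih ?_) (by fun_prop)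
      push_cast at hs
      simp only [add_re, one_re]; linarith
    have h2 := (analyticAt_powProdDeriv 0 hA hB s).meromorphicAt
    have e : integralCont A B (m + 1) = fun s => (2 * s * (((A - B) / 2 : ℝ) : ℂ) ^ 2 *
        integralCont A B m (s + 1) - ((A + B) / 2 : ℝ) * powProdDeriv 0 s s A B) / (1 - 2 * s) :=
      rfl
    rw [e]
    fun_prop

lemma analyticAt_integralCont_natCast {A B : ℝ} (hA : 0 < A) (hB : 0 < B) (m n : ℕ)
    (hmn : 1 ≤ m + n) : AnalyticAt ℂ (integralCont A B m) n := by
  induction m generalizing n with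
  | zero =>
    refine analyticAt_integral_Ioi_powProdDeriv hA hB ?_
    have : (1:ℝ) ≤ n := by exact_mod_cast (by omega : 1 ≤ n)
    simp only [natCast_re]; linarith
  | succ m ih =>
    have h1 : AnalyticAt ℂ (fun z => integralCont A B m (z + 1)) n := by
      refine AnalyticAt.fun_comp (f := fun z : ℂ => z + 1) ?_ (by fun_prop)
      exact_mod_cast ih (n + 1) (by omega)
    have h2 := analyticAt_powProdDeriv 0 hA hB n
    have h3 : (1:ℂ) - 2 * n ≠ 0 := fun h => by
      have : (1:ℂ) = ((2 * n : ℕ) : ℂ) := by push_cast; linear_combination h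
      have := Nat.cast_injective (R := ℂ) (by simpa using this : ((1:ℕ):ℂ) = ((2 * n : ℕ) : ℂ))
      omega
    have e : integralCont A B (m + 1) = fun s => (2 * s * (((A - B) / 2 : ℝ) : ℂ) ^ 2 *
        integralCont A B m (s + 1) - ((A + B) / 2 : ℝ) * powProdDeriv 0 s s A B) / (1 - 2 * s) :=
      rfl
    rw [e]
    fun_prop (disch := assumption)

lemma integralCont_succ_zero (A B : ℝ) (m : ℕ) :
    integralCont A B (m + 1) 0 = -((A + B) / 2 : ℝ) := by
  simp [integralCont, powProdDeriv]

lemma summable_one_add_add_rpow {r : ℝ} (hr : 2 < r) :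
    Summable (fun p : ℕ × ℕ => (1 + p.1 + p.2 : ℝ) ^ (-r)) := by
  have h1 : Summable (fun n : ℕ => (1 + n : ℝ) ^ (-(r / 2))) := by
    simpa [add_comm] using (summable_nat_add_iff 1).2
      (Real.summable_nat_rpow.2 (by linarith : -(r / 2) < -1))
  refine Summable.of_nonneg_of_le (fun p => by positivity) (fun p => ?_)
    (h1.mul_of_nonneg h1 (fun n => by positivity) (fun n => by positivity))
  rw [← Real.mul_rpow (by positivity) (by positivity),
    show -r = 2 * -(r / 2) by ring, Real.rpow_mul (by positivity)]
  refine Real.rpow_le_rpow_of_nonpos (by positivity) ?_ (by linarith)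
  rw [Real.rpow_two]
  have h2 : (0:ℝ) ≤ p.1 := Nat.cast_nonneg _
  have h3 : (0:ℝ) ≤ p.2 := Nat.cast_nonneg _
  nlinarith [mul_nonneg h2 h3]

lemma isComparableFamily_lattice {A B x : ℝ} (hA : 0 < A) (hB : 0 < B) (hx : x ∈ Ioc (0:ℝ) 1) :
    IsComparableFamily (fun p : ℕ × ℕ => (x + p.1) * A + p.2) (fun p => (x + p.1) * B + p.2)
      (fun p => (1 + p.1 + p.2 : ℝ)) (x * min (min A B) 1) (A + B + 1) 2 := by
  obtain ⟨hx0, hx1⟩ := hx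
  set m := min (min A B) 1
  have hm : 0 < m := lt_min (lt_min hA hB) one_pos
  have hmA : m ≤ A := (min_le_left _ _).trans (min_le_left _ _)
  have hmB : m ≤ B := (min_le_left _ _).trans (min_le_right _ _)
  have hm1 : m ≤ 1 := min_le_right _ _
  have hge : ∀ D : ℝ, m ≤ D → ∀ p : ℕ × ℕ, ∀ t ∈ Icc (0:ℝ) 1,
      x * m * (1 + p.1 + p.2) ≤ (x + p.1) * D + p.2 + t := by
    intro D hD p t ht
    have h1 : x * m * 1 ≤ x * D := by rw [mul_one]; gcongr
    have h2 : x * m * p.1 ≤ p.1 * D := by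
      rw [mul_comm (p.1 : ℝ)]
      gcongr
      nlinarith
    have h3 : x * m * p.2 ≤ p.2 := by
      refine mul_le_of_le_one_left (by positivity) ?_
      nlinarith
    nlinarith [ht.1]
  have hle : ∀ D : ℝ, 0 < D → D ≤ A + B → ∀ p : ℕ × ℕ, ∀ t ∈ Icc (0:ℝ) 1,
      (x + p.1) * D + p.2 + t ≤ (A + B + 1) * (1 + p.1 + p.2) := by
    intro D hD0 hD p t ht
    have h1 : (x + p.1) * D ≤ (1 + p.1) * (A + B) := by gcongr
    have h2 : (0:ℝ) ≤ (A + B) * p.2 := by positivity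
    have h3 : (0:ℝ) ≤ p.1 := by positivity
    nlinarith [ht.2]
  exact {
    pos := by positivity
    one_le := fun p => by
      have : (0:ℝ) ≤ p.1 + p.2 := by positivity
      linarith
    left_ge := hge A hmA
    left_le := hle A hA (by linarith)
    right_ge := hge B hmB
    right_le := hle B hB (by linarith)
    summable := fun r hr => summable_one_add_add_rpow hr }

lemma tsum_integral_powProdDeriv {A B : ℝ} (hA : 0 < A) (hB : 0 < B) {s : ℂ}
    (hs : 1 / 2 < s.re)
    (hsum : Summable (fun n : ℕ => ∫ t in (0:ℝ)..1, powProdDeriv 0 s s (A + n + t) (B + n + t))) :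
    ∑' n : ℕ, ∫ t in (0:ℝ)..1, powProdDeriv 0 s s (A + n + t) (B + n + t) =
      ∫ t in Ioi (0:ℝ), powProdDeriv 0 s s (A + t) (B + t) := by
  have hi := integrableOn_powProdDeriv hA hB hs
  refine tendsto_nhds_unique hsum.hasSum.tendsto_sum_nat ?_
  refine (intervalIntegral_tendsto_integral_Ioi 0 hi tendsto_natCast_atTop_atTop).congr fun N => ?_
  have := intervalIntegral.sum_integral_adjacent_intervals (a := fun n : ℕ => (n : ℝ)) (n := N)
    (f := fun t => powProdDeriv 0 s s (A + t) (B + t)) (μ := volume) (fun k _ => ?_)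
  · simp only [Nat.cast_zero] at this
    rw [← this]
    refine Finset.sum_congr rfl fun n _ => ?_
    have e := intervalIntegral.integral_comp_add_left (a := 0) (b := 1)
      (fun t => powProdDeriv 0 s s (A + t) (B + t)) (n : ℝ)
    simp only [← add_assoc, add_zero] at e
    rw [e, Nat.cast_succ]
  · rw [intervalIntegrable_iff_integrableOn_Ioc_of_le (by simp)]
    exact hi.mono_set fun t ht => lt_of_le_of_lt (Nat.cast_nonneg k) ht.1

lemma integral_Ioi_powProdDeriv_mul {A B a : ℝ} (hA : 0 < A) (hB : 0 < B) (ha : 0 < a) (s : ℂ) :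
    ∫ t in Ioi (0:ℝ), powProdDeriv 0 s s (a * A + t) (a * B + t) =
      (a : ℂ) ^ (-(2 * s - 1)) * ∫ t in Ioi (0:ℝ), powProdDeriv 0 s s (A + t) (B + t) := by
  have ha' : (a : ℂ) ≠ 0 := by exact_mod_cast ha.ne'
  have := integral_comp_mul_left_Ioi' (fun t => powProdDeriv 0 s s (a * A + t) (a * B + t)) 0 ha
  rw [mul_zero] at this
  rw [← this, ← integral_const_mul, ← integral_smul]
  refine setIntegral_congr_fun measurableSet_Ioi fun t ht => ?_
  have ht' : 0 < t := ht
  simp only [← mul_add]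
  rw [powProdDeriv_mul 0 s s ha (by positivity) (by positivity), real_smul, ← mul_assoc]
  congr 1
  rw [show -(2 * s - 1) = 1 + -(s + s + (0:ℕ)) by push_cast; ring, cpow_add _ _ ha', cpow_one]

open HurwitzZeta in
lemma tsum_cpow_neg_eq_hurwitzZeta {x : ℝ} (hx : x ∈ Ioc (0:ℝ) 1) {s : ℂ} (hs : 1 < s.re) :
    ∑' n : ℕ, ((x + n : ℝ) : ℂ) ^ (-s) = hurwitzZeta x s := by
  rw [← (hasSum_hurwitzZeta_of_one_lt_re ⟨hx.1.le, hx.2⟩ hs).tsum_eq]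
  refine tsum_congr fun n => ?_
  push_cast
  rw [cpow_neg, one_div, add_comm]

open HurwitzZeta in
/-- The meromorphic continuation of
`∑ p : ℕ × ℕ, (((x + p.1) * A + p.2 + y) * ((x + p.1) * B + p.2 + y)) ^ (-s)` provided by
`N` steps of the Euler-Maclaurin formula in `p.2`. -/
noncomputable def latticeCont (A B x y : ℝ) (N m : ℕ) (s : ℂ) : ℂ :=
  IsComparableFamily.remSum (fun p : ℕ × ℕ => (x + p.1) * A + p.2) (fun p => (x + p.1) * B + p.2)
    (N + 1) y s + integralCont A B m s * hurwitzZeta x (2 * s - 1) -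
  ∑ k ∈ Finset.range N, ((bernoulliFun (k + 1) y / (k + 1).factorial : ℝ) : ℂ) *
    (powProdDeriv k s s A B * hurwitzZeta x (2 * s + k))

lemma tsum_powProdDeriv_eq_latticeCont {A B x y : ℝ} (hA : 0 < A) (hB : 0 < B)
    (hx : x ∈ Ioc (0:ℝ) 1) (hy : y ∈ Icc (0:ℝ) 1) (N m : ℕ) {s : ℂ} (hs : 1 < s.re) :
    ∑' p : ℕ × ℕ, powProdDeriv 0 s s ((x + p.1) * A + p.2 + y) ((x + p.1) * B + p.2 + y) =
      latticeCont A B x y N m s := by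
  have hF := isComparableFamily_lattice hA hB hx
  have h1 : (1:ℝ) ∈ Icc (0:ℝ) 1 := by simp
  have h0 : (0:ℝ) ∈ Icc (0:ℝ) 1 := by simp
  have hpos : ∀ n : ℕ, 0 < x + n := fun n => by have := hx.1; positivity
  have e1 : ∑' p : ℕ × ℕ, (∫ t in (0:ℝ)..1,
      powProdDeriv 0 s s ((x + p.1) * A + p.2 + t) ((x + p.1) * B + p.2 + t)) =
      integralCont A B m s * HurwitzZeta.hurwitzZeta x (2 * s - 1) := by
    have hsum := hF.summable_integral (s := s) (by linarith)
    rw [hsum.tsum_prod, ← tsum_cpow_neg_eq_hurwitzZeta hx (by simp; linarith), ← tsum_mul_left]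
    refine tsum_congr fun n => ?_
    rw [tsum_integral_powProdDeriv (mul_pos (hpos n) hA) (mul_pos (hpos n) hB) (by linarith)
      (hsum.prod_factor n), integral_Ioi_powProdDeriv_mul hA hB (hpos n),
      integralCont_eq hA hB m (by linarith), integralCont, mul_comm]
  have e2 : ∀ k : ℕ, ∑' p : ℕ × ℕ,
      (powProdDeriv k s s ((x + p.1) * A + p.2 + 1) ((x + p.1) * B + p.2 + 1) -
        powProdDeriv k s s ((x + p.1) * A + p.2 + 0) ((x + p.1) * B + p.2 + 0)) =
      -(powProdDeriv k s s A B * HurwitzZeta.hurwitzZeta x (2 * s + k)) := by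
    intro k
    have hk : 2 < 2 * s.re + k := by
      have : (0:ℝ) ≤ k := Nat.cast_nonneg k
      linarith
    have hs1 := (hF.summable_norm_powProdDeriv k hk h1).of_norm
    have hs0 := (hF.summable_norm_powProdDeriv k hk h0).of_norm
    rw [(hs1.sub hs0).tsum_prod, ← tsum_cpow_neg_eq_hurwitzZeta hx (by simp; linarith),
      ← tsum_mul_left, ← tsum_neg]
    refine tsum_congr fun n => ?_
    have := tsum_succ_sub_eq_neg (hs0.prod_factor n)
    simp only [Nat.cast_add, Nat.cast_one, add_zero, Nat.cast_zero, ← add_assoc] at this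
    simp only [add_zero]
    rw [this, powProdDeriv_mul k s s (hpos n) hA hB, mul_comm, two_mul]
  rw [hF.tsum_eq_remSum_add N hy (by linarith), e1, latticeCont]
  simp only [e2, mul_neg, Finset.sum_neg_distrib]
  exact (sub_eq_add_neg _ _).symm

lemma meromorphicAt_hurwitzZeta_affine (x : UnitAddCircle) (c s : ℂ) :
    MeromorphicAt (fun s => HurwitzZeta.hurwitzZeta x (2 * s + c)) s :=
  (meromorphicAt_hurwitzZeta x _).comp_analyticAt (g := fun s => 2 * s + c) (by fun_prop)

lemma meromorphicAt_latticeCont {A B x y : ℝ} (hA : 0 < A) (hB : 0 < B)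
    (hx : x ∈ Ioc (0:ℝ) 1) (hy : y ∈ Icc (0:ℝ) 1) {N m : ℕ} {s : ℂ}
    (hN : 2 < 2 * s.re + (N + 1 : ℕ)) (hm : 1 / 2 - m < s.re) :
    MeromorphicAt (latticeCont A B x y N m) s := by
  have h1 := ((isComparableFamily_lattice hA hB hx).analyticAt_remSum N hy hN).meromorphicAt
  have h2 := meromorphicAt_integralCont hA hB m hm
  have h3 := meromorphicAt_hurwitzZeta_affine x (-1) s
  have h4 : MeromorphicAt (fun s => ∑ k ∈ Finset.range N,
      ((bernoulliFun (k + 1) y / (k + 1).factorial : ℝ) : ℂ) *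
        (powProdDeriv k s s A B * HurwitzZeta.hurwitzZeta x (2 * s + k))) s := by
    refine MeromorphicAt.fun_sum fun k _ => ?_
    exact (MeromorphicAt.const _ _).mul
      ((analyticAt_powProdDeriv k hA hB s).meromorphicAt.mul
        (meromorphicAt_hurwitzZeta_affine x k s))
  exact (h1.add (h2.mul h3)).sub h4

lemma hurwitzZeta_neg_one {x : ℝ} (hx : x ∈ Icc (0:ℝ) 1) :
    HurwitzZeta.hurwitzZeta x (-1) = -((x ^ 2 - x + 1 / 6 : ℝ) : ℂ) / 2 := by
  have := HurwitzZeta.hurwitzZeta_neg_nat one_ne_zero hx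
  rw [show (Polynomial.bernoulli (1 + 1)).map (algebraMap ℚ ℂ) =
    ((Polynomial.bernoulli 2).map (algebraMap ℚ ℝ)).map (algebraMap ℝ ℂ) by
      rw [Polynomial.map_map]; congr 1, ← coe_algebraMap, Polynomial.eval_map_apply,
    ← bernoulliFun, bernoulliFun_two] at this
  rw [Nat.cast_one] at this
  rw [this]
  simp
  ring

lemma tendsto_hurwitzZeta_affine (x : UnitAddCircle) {c : ℂ} (hc : c ≠ 1) :
    Tendsto (fun s => HurwitzZeta.hurwitzZeta x (2 * s + c)) (𝓝[≠] 0)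
      (𝓝 (HurwitzZeta.hurwitzZeta x c)) := by
  have h : ContinuousAt (HurwitzZeta.hurwitzZeta x) (2 * 0 + c) := by
    rw [mul_zero, zero_add]
    exact (HurwitzZeta.differentiableAt_hurwitzZeta x hc).continuousAt
  have h2 : ContinuousAt (fun s : ℂ => 2 * s + c) 0 := by fun_prop
  have := (ContinuousAt.comp (f := fun s : ℂ => 2 * s + c) h h2).tendsto
  simp only [Function.comp_def, mul_zero, zero_add] at this
  exact this.mono_left nhdsWithin_le_nhds

lemma tendsto_mul_hurwitzZeta (x : UnitAddCircle) :
    Tendsto (fun s => s * HurwitzZeta.hurwitzZeta x (2 * s + 1)) (𝓝[≠] 0) (𝓝 (1 / 2)) := by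
  have h : Tendsto (fun s : ℂ => 2 * s + 1) (𝓝[≠] 0) (𝓝[≠] 1) := by
    refine tendsto_nhdsWithin_iff.2 ⟨?_, ?_⟩
    · have : ContinuousAt (fun s : ℂ => 2 * s + 1) 0 := by fun_prop
      simpa using this.tendsto.mono_left nhdsWithin_le_nhds
    · filter_upwards [self_mem_nhdsWithin] with s hs
      simpa using hs
  refine (((HurwitzZeta.hurwitzZeta_residue_one x).comp h).const_mul (1 / 2)).congr' ?_ |>.trans ?_
  · exact Eventually.of_forall fun s => by simp only [Function.comp]; ring
  · simp

lemma tendsto_latticeCont {A B x y : ℝ} (hA : 0 < A) (hB : 0 < B)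
    (hx : x ∈ Ioc (0:ℝ) 1) (hy : y ∈ Icc (0:ℝ) 1) (N m : ℕ) :
    Tendsto (latticeCont A B x y (N + 2) (m + 1)) (𝓝[≠] 0)
      (𝓝 (((A + B) / 4 * (x ^ 2 - x + 1 / 6) + (x - 1 / 2) * (y - 1 / 2) +
        1 / 4 * (1 / A + 1 / B) * (y ^ 2 - y + 1 / 6) : ℝ) : ℂ)) := by
  have hA' : (A : ℂ) ≠ 0 := by exact_mod_cast hA.ne'
  have hB' : (B : ℂ) ≠ 0 := by exact_mod_cast hB.ne'
  have hF := isComparableFamily_lattice hA hB hx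
  have h1 := ((hF.analyticAt_remSum (N + 2) hy (s := 0) (by
    have : (0:ℝ) ≤ N := Nat.cast_nonneg N
    push_cast; simp; linarith)).continuousAt.tendsto).mono_left
      (nhdsWithin_le_nhds (s := {0}ᶜ))
  rw [hF.remSum_zero] at h1
  have h2 := ((analyticAt_integralCont_natCast hA hB (m + 1) 0 (by omega)).continuousAt.tendsto)
  rw [Nat.cast_zero, integralCont_succ_zero] at h2
  replace h2 := h2.mono_left (nhdsWithin_le_nhds (s := {0}ᶜ))
  have h3 := tendsto_hurwitzZeta_affine x (c := -1) (by norm_num)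
  rw [hurwitzZeta_neg_one ⟨hx.1.le, hx.2⟩] at h3
  have hP : ∀ k, Tendsto (fun s => powProdDeriv k s s A B) (𝓝[≠] 0) (𝓝 (powProdDeriv k 0 0 A B)) :=
    fun k => (analyticAt_powProdDeriv k hA hB 0).continuousAt.tendsto.mono_left nhdsWithin_le_nhds
  have h4 := (hP 0).mul (tendsto_hurwitzZeta_affine x (c := 0) (by norm_num))
  rw [hurwitzZeta_apply_zero hx] at h4
  have h5 : Tendsto (fun s => powProdDeriv 1 s s A B * HurwitzZeta.hurwitzZeta x (2 * s + 1))
      (𝓝[≠] 0) (𝓝 (-(1 / A + 1 / B) / 2)) := by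
    have h6 : Tendsto (fun s => powProdDeriv 0 (s + 1) s A B + powProdDeriv 0 s (s + 1) A B)
        (𝓝[≠] 0) (𝓝 (1 / A + 1 / B)) := by
      have h7 : ContinuousAt
          (fun s => powProdDeriv 0 (s + 1) s A B + powProdDeriv 0 s (s + 1) A B) 0 :=
        ((differentiable_powProdDeriv 0 (by fun_prop) (by fun_prop) hA hB).add
          (differentiable_powProdDeriv 0 (by fun_prop) (by fun_prop) hA hB)).continuous.continuousAt
      simpa [powProdDeriv, cpow_neg] using h7.tendsto.mono_left (nhdsWithin_le_nhds (s := {0}ᶜ))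
    have := (h6.mul (tendsto_mul_hurwitzZeta x)).neg
    rw [show (-((1 / A + 1 / B) * (1 / 2)) : ℂ) = -(1 / A + 1 / B) / 2 by ring] at this
    refine this.congr fun s => ?_
    simp only [powProdDeriv]
    ring
  have h8 : ∀ k ∈ Finset.range N, Tendsto (fun s =>
      ((bernoulliFun (k + 1 + 1 + 1) y / (k + 1 + 1 + 1).factorial : ℝ) : ℂ) *
        (powProdDeriv (k + 1 + 1) s s A B * HurwitzZeta.hurwitzZeta x (2 * s + (k + 1 + 1 : ℕ))))
      (𝓝[≠] 0) (𝓝 0) := by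
    intro k _
    have := ((hP (k + 1 + 1)).mul (tendsto_hurwitzZeta_affine x (c := (k + 1 + 1 : ℕ))
      (by exact_mod_cast (by omega : k + 1 + 1 ≠ 1)))).const_mul
        ((bernoulliFun (k + 1 + 1 + 1) y / (k + 1 + 1 + 1).factorial : ℝ) : ℂ)
    rwa [powProdDeriv_succ_zero_zero, zero_mul, mul_zero] at this
  have key := (h1.add (h2.mul h3)).sub (((tendsto_finsetSum _ h8).add
    (h5.const_mul ((bernoulliFun 2 y / 2 : ℝ) : ℂ))).add
      (h4.const_mul ((bernoulliFun 1 y : ℝ) : ℂ)))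
  refine (key.congr fun s => ?_).trans (le_of_eq ?_)
  · rw [latticeCont, Finset.sum_range_succ', Finset.sum_range_succ']
    simp [sub_eq_add_neg, Nat.factorial]
  · congr 1
    simp only [bernoulliFun_one, bernoulliFun_two, powProdDeriv]
    push_cast
    simp
    ring

lemma eventually_eq_nhdsNE_of_isPreconnected {f g : ℂ → ℂ} {V : Set ℂ} (hV : IsPreconnected V)
    (hf : MeromorphicOn f V) (hg : MeromorphicOn g V) {a b : ℂ} (ha : a ∈ V) (hb : b ∈ V)
    (h : f =ᶠ[𝓝[≠] a] g) : f =ᶠ[𝓝[≠] b] g := by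
  have h1 := mt (MeromorphicOn.meromorphicOrderAt_ne_top_of_isPreconnected (hf.sub hg) hV hb ha)
  simp only [ne_eq, not_not, meromorphicOrderAt_eq_top_iff] at h1
  filter_upwards [h1 (h.mono fun z hz => by simp [hz])] with z hz using sub_eq_zero.1 hz

lemma exists_isPreconnected_re_gt {U : Set ℂ} (hU : IsOpen U) (hc : IsConnected U) {a b : ℂ}
    (ha : a ∈ U) (hb : b ∈ U) :
    ∃ V ⊆ U, IsPreconnected V ∧ a ∈ V ∧ b ∈ V ∧ ∃ L : ℝ, ∀ z ∈ V, L < z.re := by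
  obtain ⟨γ, hγ⟩ := (hU.isConnected_iff_isPathConnected.1 hc).joinedIn a ha b hb
  have hcomp : IsCompact (range γ) := isCompact_range γ.continuous
  obtain ⟨L, hL⟩ := (hcomp.image continuous_re).bddBelow
  refine ⟨range γ, range_subset_iff.2 hγ, isPreconnected_range γ.continuous,
    ⟨0, γ.source⟩, ⟨1, γ.target⟩, L - 1, fun z hz => ?_⟩
  linarith [hL (mem_image_of_mem re hz)]

/-- Shintani's formula: the double series
`Z(s) = Σ_{n₁,n₂ ≥ 0} [((x+n₁)δ + (y+n₂))((x+n₁)δ′ + (y+n₂))]^{-s}`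
converges absolutely for `Re(s) > 1`, and any analytic continuation of it to a connected
open set containing the half plane `Re(s) > 1` and `0` takes the value
`((δ+δ′)/4)B₂(x) + B₁(x)B₁(y) + (1/4)(1/δ + 1/δ′)B₂(y)` at `s = 0`. -/
theorem stmt_5 (δ δ' x y : ℝ) (hδ : 1 < δ) (hδ'0 : 0 < δ') (hδ'1 : δ' < 1)
    (hx : x ∈ Set.Ioc (0:ℝ) 1) (hy : y ∈ Set.Ico (0:ℝ) 1) :
    (∀ s : ℂ, 1 < s.re →
      Summable (fun p : ℕ × ℕ =>
        ‖((((x + p.1) * δ + (y + p.2)) * ((x + p.1) * δ' + (y + p.2)) : ℝ) : ℂ) ^ (-s)‖)) ∧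
    (∀ (U : Set ℂ) (F : ℂ → ℂ), IsOpen U → IsConnected U →
      ({s : ℂ | 1 < s.re} ∪ {0}) ⊆ U → AnalyticOnNhd ℂ F U →
      (∀ s ∈ {s : ℂ | 1 < s.re},
        F s = ∑' p : ℕ × ℕ,
          ((((x + p.1) * δ + (y + p.2)) * ((x + p.1) * δ' + (y + p.2)) : ℝ) : ℂ) ^ (-s)) →
      F 0 = (((δ + δ')/4 * B2 x + B1 x * B1 y + (1/4) * (1/δ + 1/δ') * B2 y : ℝ) : ℂ)) := by
  have hδ0 : 0 < δ := one_pos.trans hδ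
  have hy' : y ∈ Icc (0:ℝ) 1 := ⟨hy.1, hy.2.le⟩
  have hF := isComparableFamily_lattice hδ0 hδ'0 hx
  have hterm : ∀ (s : ℂ) (p : ℕ × ℕ),
      ((((x + p.1) * δ + (y + p.2)) * ((x + p.1) * δ' + (y + p.2)) : ℝ) : ℂ) ^ (-s) =
        powProdDeriv 0 s s ((x + p.1) * δ + p.2 + y) ((x + p.1) * δ' + p.2 + y) := fun s p => by
    rw [ofReal_mul, mul_cpow_ofReal_nonneg, powProdDeriv, add_comm y, add_assoc, add_assoc]
    · exact add_comm y p.2 ▸ add_assoc _ _ y ▸ (hF.left_pos p hy').le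
    · exact add_comm y p.2 ▸ add_assoc _ _ y ▸ (hF.right_pos p hy').le
  simp only [hterm]
  refine ⟨fun s hs => hF.summable_norm_powProdDeriv 0 (by push_cast; linarith) hy', ?_⟩
  intro U F hU hc hsub hFa hFeq
  obtain ⟨V, hVU, hV, h2, h0, L, hL⟩ := exists_isPreconnected_re_gt hU hc
    (hsub (Or.inl (show (1:ℝ) < (2:ℂ).re by simp))) (hsub (Or.inr rfl))
  obtain ⟨N, hN⟩ := exists_nat_gt (-2 * L + 2)
  obtain ⟨m, hm⟩ := exists_nat_gt (-L + 1)
  have hM : MeromorphicOn (latticeCont δ δ' x y (N + 2) (m + 1)) V := fun z hz =>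
    meromorphicAt_latticeCont hδ0 hδ'0 hx hy' (by push_cast; linarith [hL z hz])
      (by push_cast; linarith [hL z hz])
  have hev : F =ᶠ[𝓝[≠] 2] latticeCont δ δ' x y (N + 2) (m + 1) := by
    refine Eventually.filter_mono nhdsWithin_le_nhds ?_
    filter_upwards [(isOpen_lt continuous_const continuous_re).mem_nhds
      (show (1:ℝ) < (2:ℂ).re by simp)] with s hs
    rw [hFeq s hs, tsum_powProdDeriv_eq_latticeCont hδ0 hδ'0 hx hy' _ _ hs]
  have hev0 := eventually_eq_nhdsNE_of_isPreconnected hV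
    (fun z hz => (hFa z (hVU hz)).meromorphicAt) hM h2 h0 hev
  refine tendsto_nhds_unique
    ((hFa 0 (hVU h0)).continuousAt.tendsto.mono_left (nhdsWithin_le_nhds (s := {0}ᶜ))) ?_
  exact (tendsto_latticeCont hδ0 hδ'0 hx hy' N m).congr' (hev0.mono fun z hz => hz.symm)
end

section
/- Let C, D be integers with 0 ≤ C, D ≤ q−1. Then for all integers i ∈ ℤ and all j with 0 ≤ j ≤ m−1, x^{mi+j}_{C+Dδ} = x^{j}_{ε^{i}∗(C+Dδ)} and y^{mi+j}_{C+Dδ} = y^{j}_{ε^{i}∗(C+Dδ)}, where ε^{i}∗(C+Dδ) := C′ + D′δ is the unique element with integers 0 ≤ C′, D′ ≤ q−1 such that ε^{i}·(C + Dδ) − (C′ + D′δ) ∈ q𝔟⁻¹. -/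
open NumberField FractionalIdeal
open scoped nonZeroDivisors

/-- Iterating the shift relation `e * A i = A (i - m)`. -/
theorem zpow_mul_eq_of_shift {K : Type*} [Field K] {e : K} (he : e ≠ 0) {m : ℤ} {A : ℤ → K}
    (h : ∀ i, e * A i = A (i - m)) (i k : ℤ) : e ^ i * A (m * i + k) = A k := by
  induction i using Int.induction_on generalizing k with
  | zero => simp
  | succ n ih =>
    rw [zpow_add_one₀ he, mul_assoc, h]
    convert ih k using 3
    ring
  | pred n ih =>
    have h1 := h (m * (-n) + k)
    rw [show m * (-(n : ℤ)) + k - m = m * (-n - 1) + k by ring] at h1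
    rw [← h1, ← mul_assoc, ← zpow_add_one₀ he, sub_add_cancel, ih]

/-- Two real numbers which differ by an integer and lie in `(0, 1]` are equal. -/
theorem eq_of_sub_eq_intCast_of_mem_Ioc {x y : ℝ} {n : ℤ} (hx : x ∈ Set.Ioc (0 : ℝ) 1)
    (hy : y ∈ Set.Ioc (0 : ℝ) 1) (h : x - y = n) : x = y := by
  have h1 : (n : ℝ) < 1 := by linarith [hx.2, hy.1]
  have h2 : (-1 : ℝ) < n := by linarith [hy.2, hx.1]
  have hn : n = 0 := by
    have h1 : n < 1 := by exact_mod_cast h1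
    have h2 : -1 < n := by exact_mod_cast h2
    omega
  rw [hn, Int.cast_zero] at h
  linarith

/-- Two real numbers which differ by an integer and lie in `[0, 1)` are equal. -/
theorem eq_of_sub_eq_intCast_of_mem_Ico {x y : ℝ} {n : ℤ} (hx : x ∈ Set.Ico (0 : ℝ) 1)
    (hy : y ∈ Set.Ico (0 : ℝ) 1) (h : x - y = n) : x = y := by
  have := eq_of_sub_eq_intCast_of_mem_Ioc (x := 1 - y) (y := 1 - x) (n := n)
    ⟨by linarith [hy.2], by linarith [hy.1]⟩ ⟨by linarith [hx.2], by linarith [hx.1]⟩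
    (by linarith)
  linarith

/-- A homogeneous `2 × 2` linear system with nonzero determinant has only the zero solution. -/
theorem eq_zero_of_det_ne_zero {F : Type*} [Field F] {a b a' b' s t : F}
    (hdet : a * b' - b * a' ≠ 0) (h : s * a + t * b = 0) (h' : s * a' + t * b' = 0) :
    s = 0 ∧ t = 0 := by
  constructor
  · refine (mul_eq_zero.mp ?_).resolve_right hdet
    linear_combination b' * h - b * h'
  · refine (mul_eq_zero.mp ?_).resolve_right hdet
    linear_combination a * h' - a' * h

/-- Fractional ideals are stable under integer powers of units. -/
theorem units_zpow_mul_mem {K : Type*} [Field K] [NumberField K]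
    (I : FractionalIdeal (𝓞 K)⁰ K) (ε : (𝓞 K)ˣ) (i : ℤ) {w : K} (hw : w ∈ I) :
    ((ε : 𝓞 K) : K) ^ i * w ∈ I := by
  rw [← NumberField.Units.coe_zpow, ← Algebra.smul_def]
  exact Submodule.smul_mem (I : Submodule (𝓞 K) K) _ hw

/-- Lemma 2.7 of Jun–Lee: with the Shintani–Zagier data `A_i` (satisfying
`A_{-1} = δ`, `A₀ = 1`, `A_{i+1} = b_i A_i - A_{i-1}`, `{A_{i-1}, A_i}` a `ℤ`-basis of
`𝔟⁻¹`, and `ε A_i = A_{i-m}` for the totally positive fundamental unit `ε > 1`), and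
`(x^i_{C+Dδ}, y^i_{C+Dδ})` the unique pair in `(0,1] × [0,1)` with
`x^i A_{i-1} + y^i A_i ∈ (C+Dδ)/q + 𝔟⁻¹` (read off through the two real embeddings),
one has `x^{mi+j}_{C+Dδ} = x^j_{ε^i∗(C+Dδ)}` and `y^{mi+j}_{C+Dδ} = y^j_{ε^i∗(C+Dδ)}`
for all `i ∈ ℤ` and `0 ≤ j ≤ m-1`, where `ε^i∗(C+Dδ) = C' + D'δ` is characterized by
`0 ≤ C', D' ≤ q-1` and `ε^i(C+Dδ) - (C'+D'δ) ∈ q𝔟⁻¹`. -/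
theorem stmt_7 {K : Type*} [Field K] [NumberField K]
    (hdeg : Module.finrank ℚ K = 2)
    (σ σ' : K →+* ℝ) (hσσ' : σ ≠ σ')
    (q : ℕ) (hq : 0 < q)
    (𝔟 : Ideal (𝓞 K)) (hbcop : IsCoprime 𝔟 (Ideal.span {(q : 𝓞 K)}))
    (δ : K) (hδ2 : 2 < σ δ) (hδ'0 : 0 < σ' δ) (hδ'1 : σ' δ < 1)
    (hbinv : ∀ z : K,
      z ∈ ((𝔟 : FractionalIdeal (𝓞 K)⁰ K))⁻¹ ↔ ∃ a b : ℤ, z = (a : K) + (b : K) * δ)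
    -- the minus continued fraction data
    (m : ℕ) (hm : 0 < m)
    (b : ℤ → ℤ) (hb2 : ∀ i, 2 ≤ b i) (hbper : ∀ i, b (i + m) = b i)
    (δseq : ℤ → K) (hδ0 : δseq 0 = δ) (hδne : ∀ i, δseq i ≠ 0)
    (hδrec : ∀ i, δseq i = (b i : K) - 1 / δseq (i+1)) (hδper : ∀ i, δseq (i + m) = δseq i)
    (A : ℤ → K) (hAm1 : A (-1) = δ) (hA0 : A 0 = 1)
    (hArec : ∀ i : ℤ, A (i+1) = (b i : K) * A i - A (i-1))
    (hAbasis : ∀ i : ℤ, ∀ z : K,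
      z ∈ ((𝔟 : FractionalIdeal (𝓞 K)⁰ K))⁻¹ ↔ ∃ u v : ℤ, z = (u : K) * A (i-1) + (v : K) * A i)
    -- the totally positive fundamental unit `ε > 1`
    (ε : (𝓞 K)ˣ) (hεpos : 0 < σ ((ε : 𝓞 K) : K) ∧ 0 < σ' ((ε : 𝓞 K) : K))
    (hε1 : 1 < σ ((ε : 𝓞 K) : K))
    (hεfund : ∀ u : (𝓞 K)ˣ, 0 < σ ((u : 𝓞 K) : K) → 0 < σ' ((u : 𝓞 K) : K) →
      ∃ j : ℤ, ((u : 𝓞 K) : K) = (((ε : 𝓞 K) : K)) ^ j)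
    (hshift : ∀ i : ℤ, ((ε : 𝓞 K) : K) * A i = A (i - m))
    -- the pairs `(x^i_{C+Dδ}, y^i_{C+Dδ})`
    (X Y : ℤ → ℤ → ℤ → ℝ)
    (hXY : ∀ C D i : ℤ, X C D i ∈ Set.Ioc (0:ℝ) 1 ∧ Y C D i ∈ Set.Ico (0:ℝ) 1 ∧
      ∃ z : K, (z - ((C : K) + (D : K) * δ) / (q : K)) ∈ ((𝔟 : FractionalIdeal (𝓞 K)⁰ K))⁻¹ ∧
        X C D i * σ (A (i-1)) + Y C D i * σ (A i) = σ z ∧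
        X C D i * σ' (A (i-1)) + Y C D i * σ' (A i) = σ' z)
    (C D : ℤ) (hC : 0 ≤ C) (hCq : C ≤ (q:ℤ) - 1) (hD : 0 ≤ D) (hDq : D ≤ (q:ℤ) - 1) :
    ∀ i : ℤ, ∀ j : ℤ, 0 ≤ j → j ≤ (m : ℤ) - 1 →
      ∀ C' D' : ℤ, 0 ≤ C' → C' ≤ (q:ℤ) - 1 → 0 ≤ D' → D' ≤ (q:ℤ) - 1 →
      ((((ε : 𝓞 K) : K)) ^ i * ((C : K) + (D : K) * δ) - ((C' : K) + (D' : K) * δ))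
          ∈ spanSingleton (𝓞 K)⁰ (q : K) * ((𝔟 : FractionalIdeal (𝓞 K)⁰ K))⁻¹ →
      X C D ((m : ℤ) * i + j) = X C' D' j ∧ Y C D ((m : ℤ) * i + j) = Y C' D' j := by
  intro i j _ _ C' D' _ _ _ _ hmem
  have hqK : (q : K) ≠ 0 := by exact_mod_cast hq.ne'
  have he : ((ε : 𝓞 K) : K) ≠ 0 := by
    intro h
    rw [h, map_zero] at hε1
    linarith
  have hsh := zpow_mul_eq_of_shift he hshift i
  obtain ⟨w, hw, hwe⟩ := FractionalIdeal.mem_singleton_mul.mp hmem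
  obtain ⟨hx, hy, z, hz, hzσ, hzσ'⟩ := hXY C D (m * i + j)
  obtain ⟨hx', hy', z', hz', hz'σ, hz'σ'⟩ := hXY C' D' j
  have hdiff : ((ε : 𝓞 K) : K) ^ i * z - z' ∈ ((𝔟 : FractionalIdeal (𝓞 K)⁰ K))⁻¹ := by
    have hsum := Submodule.sub_mem (((𝔟 : FractionalIdeal (𝓞 K)⁰ K)⁻¹ : FractionalIdeal (𝓞 K)⁰ K) :
      Submodule (𝓞 K) K) (Submodule.add_mem _ (units_zpow_mul_mem _ ε i hz) hw) hz'
    have heq : ((ε : 𝓞 K) : K) ^ i * z - z' =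
        ((ε : 𝓞 K) : K) ^ i * (z - (C + D * δ) / q) + w - (z' - (C' + D' * δ) / q) := by
      field_simp
      linear_combination hwe
    rw [heq]
    exact hsum
  obtain ⟨u, v, huv⟩ := (hAbasis j _).mp hdiff
  obtain ⟨s, t, hst⟩ := (hAbasis j 1).mp ((hbinv 1).mpr ⟨1, 0, by simp⟩)
  obtain ⟨s', t', hst'⟩ := (hAbasis j δ).mp ((hbinv δ).mpr ⟨0, 1, by simp⟩)
  have hdet : σ (A (j - 1)) * σ' (A j) - σ (A j) * σ' (A (j - 1)) ≠ 0 := by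
    intro h0
    have h1 := congrArg σ hst
    have h2 := congrArg σ' hst
    have h3 := congrArg σ hst'
    have h4 := congrArg σ' hst'
    simp only [map_add, map_mul, map_intCast, map_one] at h1 h2 h3 h4
    have : σ δ - σ' δ = 0 := by
      linear_combination (s' * t - s * t' : ℝ) * h0 + σ δ * h2 - σ' δ * h1 +
        (s * σ' (A (j - 1)) + t * σ' (A j)) * h3 - (s * σ (A (j - 1)) + t * σ (A j)) * h4
    linarith
  have key : ∀ τ : K →+* ℝ,
      X C D (m * i + j) * τ (A (m * i + j - 1)) + Y C D (m * i + j) * τ (A (m * i + j)) = τ z →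
      X C' D' j * τ (A (j - 1)) + Y C' D' j * τ (A j) = τ z' →
      (X C D (m * i + j) - X C' D' j - u) * τ (A (j - 1)) +
        (Y C D (m * i + j) - Y C' D' j - v) * τ (A j) = 0 := by
    intro τ h h'
    have h1 := congrArg τ (hsh (j - 1))
    have h2 := congrArg τ (hsh j)
    have h3 := congrArg τ huv
    rw [← add_sub_assoc] at h1
    simp only [map_add, map_sub, map_mul, map_intCast] at h1 h2 h3
    linear_combination τ (((ε : 𝓞 K) : K) ^ i) * h - h' + h3 -
      X C D (m * i + j) * h1 - Y C D (m * i + j) * h2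
  obtain ⟨hX, hY⟩ := eq_zero_of_det_ne_zero hdet (key σ hzσ hz'σ) (key σ' hzσ' hz'σ')
  exact ⟨eq_of_sub_eq_intCast_of_mem_Ioc hx hx' (sub_eq_zero.mp hX),
    eq_of_sub_eq_intCast_of_mem_Ico hy hy' (sub_eq_zero.mp hY)⟩
end
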